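/- Let d ≥ 3, n, m ≥ 1. Define s_1 to be the largest multiple of (n+1) that is at most ⌊(n+1)·C(m+d,d)/(m+n+1)⌋, and s_2 to be the smallest multiple of (n+1) that is at least ⌈(n+1)·C(m+d,d)/(m+n+1)⌉. Let P_1, …, P_s be generic points of P^{n+m}, and let H_1 ≅ P^{n-1}, H_2 ≅ P^{m-1} be generic linear subspaces of P^{n+m}. Let X be the scheme dH_1 + H_2 + 2P_1 + ⋯ + 2P_s. Then for any s ≤ s_1 one has dim (I_X)_{d+1} = (n+1)·C(m+d,d) − s(n+m+1), and for any s ≥ s_2 one has dim (I_X)_{d+1} = 0. -/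

import Mathlib

open MvPolynomial

noncomputable section

/-- The degree-`t` homogeneous piece of an ideal `I` of a polynomial ring, as a
`K`-vector space; `Module.finrank K (piece K I t)` is `dim (I)_t`. -/
def piece (K : Type) [Field K] {ι : Type} (I : Ideal (MvPolynomial ι K)) (t : ℕ) :
    Submodule K (MvPolynomial ι K) :=
  Submodule.restrictScalars K I ⊓ MvPolynomial.homogeneousSubmodule ι K t

/-- The (saturated, radical) homogeneous ideal of the projective linear subspace spanned
by the set `S` of vectors: the ideal generated by all linear forms vanishing on `S`. -/
def linIdeal (K : Type) [Field K] {ι : Type} (S : Set (ι → K)) : Ideal (MvPolynomial ι K) :=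
  Ideal.span { f | f ∈ MvPolynomial.homogeneousSubmodule ι K 1 ∧ ∀ x ∈ S, MvPolynomial.eval x f = 0 }

section Generic

variable {K : Type*} [Field K] {σ τ : Type*}

/-- A function on an affine space which is given by a polynomial. -/
def IsPolyFun (f : (σ → K) → K) : Prop := ∃ p : MvPolynomial σ K, ∀ x, f x = eval x p

namespace IsPolyFun

lemma const (c : K) : IsPolyFun (fun _ : σ → K => c) := ⟨C c, by simp⟩

lemma coord (i : σ) : IsPolyFun (fun x : σ → K => x i) := ⟨X i, by simp⟩

lemma add {f g : (σ → K) → K} (hf : IsPolyFun f) (hg : IsPolyFun g) :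
    IsPolyFun (fun x => f x + g x) := by
  obtain ⟨p, hp⟩ := hf
  obtain ⟨q, hq⟩ := hg
  exact ⟨p + q, fun x => by simp [hp, hq]⟩

lemma mul {f g : (σ → K) → K} (hf : IsPolyFun f) (hg : IsPolyFun g) :
    IsPolyFun (fun x => f x * g x) := by
  obtain ⟨p, hp⟩ := hf
  obtain ⟨q, hq⟩ := hg
  exact ⟨p * q, fun x => by simp [hp, hq]⟩

lemma sum {A : Type*} (s : Finset A) {f : A → (σ → K) → K} (hf : ∀ a, IsPolyFun (f a)) :
    IsPolyFun (fun x => ∑ a ∈ s, f a x) := by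
  choose p hp using hf
  exact ⟨∑ a ∈ s, p a, fun x => by simp [hp]⟩

lemma prod {A : Type*} (s : Finset A) {f : A → (σ → K) → K} (hf : ∀ a, IsPolyFun (f a)) :
    IsPolyFun (fun x => ∏ a ∈ s, f a x) := by
  choose p hp using hf
  exact ⟨∏ a ∈ s, p a, fun x => by simp [hp]⟩

lemma comp {f : (τ → K) → K} {g : τ → (σ → K) → K} (hf : IsPolyFun f)
    (hg : ∀ i, IsPolyFun (g i)) : IsPolyFun (fun x => f (fun i => g i x)) := by
  obtain ⟨p, hp⟩ := hf
  choose q hq using hg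
  refine ⟨bind₁ q p, fun x => ?_⟩
  simp only [hp, hq]
  clear hp
  induction p using MvPolynomial.induction_on with
  | C a => simp
  | add p q h₁ h₂ => simp [h₁, h₂]
  | mul_X p i h => simp [h]

lemma eval_poly {g : τ → (σ → K) → K} (hg : ∀ i, IsPolyFun (g i)) (p : MvPolynomial τ K) :
    IsPolyFun (fun x => eval (fun i => g i x) p) :=
  comp (f := fun y => eval y p) ⟨p, fun _ => rfl⟩ hg

lemma det {A : Type*} [Fintype A] [DecidableEq A] {f : A → A → (σ → K) → K}
    (hf : ∀ a b, IsPolyFun (f a b)) :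
    IsPolyFun (fun x => (Matrix.of fun a b => f a b x).det) := by
  simp only [Matrix.det_apply', Matrix.of_apply]
  exact sum _ fun s => mul (const _) (prod _ fun a => hf _ _)

lemma adjugate {A : Type*} [Fintype A] [DecidableEq A] {f : A → A → (σ → K) → K}
    (hf : ∀ a b, IsPolyFun (f a b)) (i j : A) :
    IsPolyFun (fun x => (Matrix.of fun a b => f a b x).adjugate i j) := by
  simp only [Matrix.adjugate_apply]
  refine det (f := fun a b x => (Matrix.of fun a b => f a b x).updateRow j (Pi.single i 1) a b) ?_
  intro a b
  by_cases h : a = j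
  · subst h
    simpa using const _
  · simpa [Matrix.updateRow_ne h] using hf a b

end IsPolyFun

/-- The filter of the sets containing a nonempty principal Zariski open set. -/
def generic (σ K : Type*) [Field K] : Filter (σ → K) where
  sets := {s | ∃ p : MvPolynomial σ K, p ≠ 0 ∧ ∀ x, eval x p ≠ 0 → x ∈ s}
  univ_sets := ⟨1, one_ne_zero, fun _ _ => trivial⟩
  sets_of_superset := by
    rintro s t ⟨p, hp, h⟩ hst
    exact ⟨p, hp, fun x hx => hst (h x hx)⟩
  inter_sets := by
    rintro s t ⟨p, hp, h⟩ ⟨q, hq, h'⟩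
    refine ⟨p * q, mul_ne_zero hp hq, fun x hx => ?_⟩
    rw [map_mul] at hx
    exact ⟨h x (left_ne_zero_of_mul hx), h' x (right_ne_zero_of_mul hx)⟩

lemma eventually_generic {Q : (σ → K) → Prop} :
    (∀ᶠ x in generic σ K, Q x) ↔
      ∃ p : MvPolynomial σ K, p ≠ 0 ∧ ∀ x, eval x p ≠ 0 → Q x := Iff.rfl

instance [Infinite K] : (generic σ K).NeBot := by
  refine ⟨fun h => ?_⟩
  obtain ⟨p, hp, h⟩ := Filter.empty_mem_iff_bot.mpr h
  exact hp (MvPolynomial.funext fun x => by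
    by_contra hx
    exact h x (by simpa using hx))

lemma IsPolyFun.eventually_ne_zero {f : (σ → K) → K} (hf : IsPolyFun f) {x₀ : σ → K}
    (h : f x₀ ≠ 0) : ∀ᶠ x in generic σ K, f x ≠ 0 := by
  obtain ⟨p, hp⟩ := hf
  refine ⟨p, ?_, fun x hx => by simpa [hp] using hx⟩
  rintro rfl
  simp [hp] at h

/-- Being generic can be tested after restricting to a parametrized subvariety. -/
lemma eventually_generic_comp {Q : (τ → K) → Prop} {p : MvPolynomial τ K}
    (hQ : ∀ x, eval x p ≠ 0 → Q x) {g : τ → (σ → K) → K} (hg : ∀ i, IsPolyFun (g i))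
    {x₀ : σ → K} (h : eval (fun i => g i x₀) p ≠ 0) :
    ∀ᶠ x in generic σ K, Q (fun i => g i x) :=
  ((IsPolyFun.eval_poly hg p).eventually_ne_zero h).mono fun _ hx => hQ _ hx

section LinearAlgebra

variable {E A : Type*} [AddCommGroup E] [Module K E]

lemma eventually_linearIndependent [Finite A] {v : A → (σ → K) → E}
    (hv : ∀ a (φ : Module.Dual K E), IsPolyFun (fun x => φ (v a x))) {x₀ : σ → K}
    (h : LinearIndependent K (fun a => v a x₀)) :
    ∀ᶠ x in generic σ K, LinearIndependent K (fun a => v a x) := by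
  classical
  have := Fintype.ofFinite A
  obtain ⟨g, hg⟩ := LinearMap.exists_leftInverse_of_injective
    (Fintype.linearCombination K (fun a => v a x₀))
    (LinearMap.ker_eq_bot.mpr (linearIndependent_iff_injective_fintypeLinearCombination.mp h))
  have hg' (a : A) : g (v a x₀) = Pi.single a 1 := by
    have := LinearMap.congr_fun hg (Pi.single a 1)
    simpa [Fintype.linearCombination_apply_single] using this
  have hd := IsPolyFun.det (f := fun a b x => g (v a x) b)
    (fun a b => hv a (LinearMap.proj b ∘ₗ g))
  refine (hd.eventually_ne_zero (x₀ := x₀) ?_).mono fun x hx => ?_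
  · have : (Matrix.of fun a b => g (v a x₀) b) = 1 := by
      ext a b
      simp [hg', Matrix.one_apply, Pi.single_apply, eq_comm]
    simp [this]
  · exact LinearIndependent.of_comp g (Matrix.linearIndependent_rows_of_det_ne_zero hx)

lemma eventually_le_finrank_span [Finite A] [FiniteDimensional K E] {v : A → (σ → K) → E}
    (hv : ∀ a (φ : Module.Dual K E), IsPolyFun (fun x => φ (v a x))) {x₀ : σ → K} {r : ℕ}
    (h : r ≤ Module.finrank K (Submodule.span K (Set.range fun a => v a x₀))) :
    ∀ᶠ x in generic σ K,
      r ≤ Module.finrank K (Submodule.span K (Set.range fun a => v a x)) := by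
  obtain ⟨f, hf, -, hli⟩ := Submodule.exists_fun_fin_finrank_span_eq K
    (Set.range fun a => v a x₀)
  choose a ha using hf
  have h1 : LinearIndependent K (fun i => v (a i) x₀) := by simpa only [ha] using hli
  refine (eventually_linearIndependent (v := fun i => v (a i)) (fun i => hv _) h1).mono ?_
  intro x hx
  refine h.trans ?_
  have h2 := finrank_span_eq_card hx
  rw [Fintype.card_fin] at h2
  rw [← h2]
  exact Submodule.finrank_mono (Submodule.span_mono (by rintro _ ⟨i, rfl⟩; exact ⟨a i, rfl⟩))

/-- The common zeros of a family of linear functionals. -/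
def commonKer (L : A → Module.Dual K E) : Submodule K E := ⨅ a, LinearMap.ker (L a)

lemma mem_commonKer {L : A → Module.Dual K E} {F : E} : F ∈ commonKer L ↔ ∀ a, L a F = 0 := by
  simp [commonKer]

lemma finrank_span_add_finrank_commonKer [FiniteDimensional K E] (L : A → Module.Dual K E) :
    Module.finrank K (Submodule.span K (Set.range L)) + Module.finrank K (commonKer L) =
      Module.finrank K E := by
  have : commonKer L = (Submodule.span K (Set.range L)).dualCoannihilator := by
    ext F
    simp only [mem_commonKer, Submodule.mem_dualCoannihilator]
    refine ⟨fun h φ hφ => ?_, fun h a => h _ (Submodule.subset_span ⟨a, rfl⟩)⟩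
    induction hφ using Submodule.span_induction with
    | mem φ hφ => obtain ⟨a, rfl⟩ := hφ; exact h a
    | zero => simp
    | add φ ψ _ _ h1 h2 => simp [h1, h2]
    | smul c φ _ h1 => simp [h1]
  rw [this]
  exact Subspace.finrank_add_finrank_dualCoannihilator_eq _

lemma isPolyFun_dual [FiniteDimensional K E] {L : (σ → K) → Module.Dual K E}
    (hL : ∀ F, IsPolyFun (fun x => L x F)) (φ : Module.Dual K (Module.Dual K E)) :
    IsPolyFun (fun x => φ (L x)) := by
  obtain ⟨F, rfl⟩ := (Module.evalEquiv K E).surjective φ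
  simpa using hL F

lemma eventually_finrank_commonKer_le [Finite A] [FiniteDimensional K E]
    {L : A → (σ → K) → Module.Dual K E} (hL : ∀ a F, IsPolyFun (fun x => L a x F))
    {x₀ : σ → K} {r : ℕ} (h : Module.finrank K (commonKer fun a => L a x₀) ≤ r) :
    ∀ᶠ x in generic σ K, Module.finrank K (commonKer fun a => L a x) ≤ r := by
  have h0 := finrank_span_add_finrank_commonKer (fun a => L a x₀)
  refine (eventually_le_finrank_span (v := L) (fun a => isPolyFun_dual (hL a))
    (x₀ := x₀) le_rfl).mono fun x hx => ?_
  have h1 := finrank_span_add_finrank_commonKer (fun a => L a x)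
  omega

end LinearAlgebra

end Generic

section Forms

variable {K : Type*} [Field K] {ι : Type*}

/-- The space of forms of degree `d`. -/
abbrev Forms (ι K : Type*) [Field K] (d : ℕ) : Submodule K (MvPolynomial ι K) :=
  homogeneousSubmodule ι K d

instance [Finite ι] (d : ℕ) : FiniteDimensional K (Forms ι K d) :=
  Module.Finite.iff_fg.mpr (homogeneousSubmodule_fg ι K d)

lemma finrank_forms [Fintype ι] (d : ℕ) :
    Module.finrank K (Forms ι K d) = (Fintype.card ι + d - 1).choose d := by
  classical
  have e : Forms ι K d ≃ₗ[K] ({a : ι →₀ ℕ | a.degree = d} →₀ K) :=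
    LinearEquiv.ofEq _ _ (homogeneousSubmodule_eq_finsupp_supported ι K d) ≪≫ₗ
      AddMonoidAlgebra.supportedEquivFinsupp _
  have hs : {a : ι →₀ ℕ | a.degree = d} = ↑(Finset.univ.finsuppAntidiag d : Finset (ι →₀ ℕ)) := by
    ext a
    simp [Finsupp.degree_eq_sum]
  rw [e.finrank_eq, hs, Module.finrank_finsupp_self, ← Nat.card_eq_fintype_card,
    Nat.card_coe_set_eq, Set.ncard_coe_finset,
    Finset.card_finsuppAntidiag_nat_eq_choose, Finset.card_univ]

/-- The partial derivative with respect to `j` at the point `q`, as a functional on forms. -/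
def gradAt (d : ℕ) (q : ι → K) (j : ι) : Module.Dual K (Forms ι K d) :=
  (aeval q).toLinearMap ∘ₗ (pderiv j : Derivation K _ _).toLinearMap ∘ₗ (Forms ι K d).subtype

/-- Evaluation at `q`, as a functional on forms. -/
def evalAt (d : ℕ) (q : ι → K) : Module.Dual K (Forms ι K d) :=
  (aeval q).toLinearMap ∘ₗ (Forms ι K d).subtype

lemma gradAt_apply (d : ℕ) (q : ι → K) (j : ι) (F : Forms ι K d) :
    gradAt d q j F = eval q (pderiv j F.1) := by
  simp [gradAt, aeval_eq_eval]

lemma evalAt_apply (d : ℕ) (q : ι → K) (F : Forms ι K d) : evalAt d q F = eval q F.1 := by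
  simp [evalAt, aeval_eq_eval]

lemma sum_mul_gradAt [Fintype ι] (d : ℕ) (q : ι → K) (F : Forms ι K d) :
    ∑ j, q j * gradAt d q j F = d * evalAt d q F := by
  have h := congrArg (eval q) (IsHomogeneous.sum_X_mul_pderiv F.2)
  simpa [gradAt_apply, evalAt_apply] using h

lemma evalAt_eq_zero [CharZero K] [Fintype ι] {d : ℕ} (hd : d ≠ 0) {q : ι → K} {F : Forms ι K d}
    (h : ∀ j, gradAt d q j F = 0) : evalAt d q F = 0 := by
  have := sum_mul_gradAt d q F
  simp only [h, mul_zero, Finset.sum_const_zero] at this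
  exact (mul_eq_zero.mp this.symm).resolve_left (by exact_mod_cast hd)

lemma isPolyFun_gradAt {σ : Type*} (d : ℕ) {q : (σ → K) → ι → K}
    (hq : ∀ i, IsPolyFun fun x => q x i) (j : ι) (F : Forms ι K d) :
    IsPolyFun fun x => gradAt d (q x) j F := by
  simp only [gradAt_apply]
  exact IsPolyFun.eval_poly hq _

lemma isPolyFun_evalAt {σ : Type*} (d : ℕ) {q : (σ → K) → ι → K}
    (hq : ∀ i, IsPolyFun fun x => q x i) (F : Forms ι K d) :
    IsPolyFun fun x => evalAt d (q x) F := by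
  simp only [evalAt_apply]
  exact IsPolyFun.eval_poly hq _

lemma isHomogeneous_linear [Fintype ι] (t : ι → K) :
    (∑ i, C (t i) * X i : MvPolynomial ι K).IsHomogeneous 1 :=
  IsHomogeneous.sum _ _ _ fun i _ => by
    simpa using (isHomogeneous_C ι (t i)).mul (isHomogeneous_X K i)

/-- The `d`-th power of the linear form with coefficients `t`. -/
def powForm [Fintype ι] (d : ℕ) (t : ι → K) : Forms ι K d :=
  ⟨(∑ i, C (t i) * X i) ^ d, by simpa using (isHomogeneous_linear t).pow d⟩

/-- In characteristic zero the powers of linear forms span all forms. -/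
lemma dual_eq_zero_of_powForm [CharZero K] [Fintype ι] {d : ℕ} {v : Module.Dual K (Forms ι K d)}
    (h : ∀ t, v (powForm d t) = 0) : v = 0 := by
  classical
  obtain ⟨w, hw⟩ := LinearMap.exists_extend v
  have hw' (F : Forms ι K d) : v F = w F.1 := by rw [← hw]; rfl
  let Q : MvPolynomial ι K := ∑ a ∈ Finset.univ.finsuppAntidiag d,
    monomial a ((Nat.multinomial Finset.univ a : K) * w (monomial a 1))
  have hQ : Q = 0 := by
    refine MvPolynomial.funext fun t => ?_
    have h1 := h t
    rw [hw'] at h1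
    simp only [powForm] at h1
    rw [Finset.sum_pow_eq_sum_piAntidiag, map_sum] at h1
    rw [map_zero, ← h1, map_sum]
    refine Finset.sum_bij' (fun a _ => ⇑a) (fun a _ => Finsupp.equivFunOnFinite.symm a)
      ?_ ?_ ?_ ?_ ?_
    · intro a ha
      simpa using ha
    · intro a ha
      simpa using ha
    · intro a ha
      ext; simp
    · intro a ha
      ext; simp
    · intro a ha
      have : (Nat.multinomial Finset.univ a : MvPolynomial ι K) * ∏ i, (C (t i) * X i) ^ (a i) =
          ((Nat.multinomial Finset.univ a : K) * ∏ i, t i ^ a i) • monomial a 1 := by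
        simp_rw [mul_pow, Finset.prod_mul_distrib]
        rw [monomial_eq, Finsupp.prod_fintype _ _ (by simp), smul_eq_C_mul]
        simp [mul_assoc]
      rw [this, map_smul, eval_monomial, Finsupp.prod_fintype _ _ (by simp), smul_eq_mul]
      ring
  have hm (a : ι →₀ ℕ) (ha : a.degree = d) : w (monomial a 1) = 0 := by
    have h2 := congrArg (coeff a) hQ
    simp only [Q, coeff_sum, coeff_monomial, coeff_zero] at h2
    rw [Finset.sum_ite_eq', if_pos (by simpa [Finsupp.degree_eq_sum] using ha)] at h2
    refine (mul_eq_zero.mp h2).resolve_left ?_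
    exact_mod_cast (Nat.multinomial_pos _ _).ne'
  ext F
  rw [hw', F.1.as_sum, map_sum]
  refine Finset.sum_eq_zero fun a ha => ?_
  rw [show monomial a (coeff a F.1) = coeff a F.1 • monomial a (1 : K) by simp [smul_monomial],
    map_smul, hm a, smul_zero]
  have := F.2 (mem_support_iff.mp ha)
  rw [← this, Finsupp.degree_eq_weight_one]
  rfl

end Forms

section Substitution

variable {K : Type*} [Field K] {ι : Type*} [Fintype ι]

lemma IsPolyFun.eq_zero_of_eventually {σ : Type*} [Infinite K] {f : (σ → K) → K}
    (hf : IsPolyFun f) (h : ∀ᶠ x in generic σ K, f x = 0) (x : σ → K) : f x = 0 := by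
  by_contra hx
  obtain ⟨y, h1, h2⟩ := (h.and (hf.eventually_ne_zero hx)).exists
  exact h2 h1

/-- The linear substitution of variables given by a matrix. -/
def linSubst (B : Matrix ι ι K) : MvPolynomial ι K →ₐ[K] MvPolynomial ι K :=
  aeval fun i => ∑ j, C (B i j) * X j

lemma linSubst_X (B : Matrix ι ι K) (i : ι) : linSubst B (X i) = ∑ j, C (B i j) * X j := by
  simp [linSubst]

lemma eval_linSubst (B : Matrix ι ι K) (x : ι → K) (F : MvPolynomial ι K) :
    eval x (linSubst B F) = eval (B.mulVec x) F := by
  induction F using MvPolynomial.induction_on with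
  | C a => simp [linSubst]
  | add p q h₁ h₂ => simp [h₁, h₂]
  | mul_X p i h => simp [h, linSubst_X, Matrix.mulVec, dotProduct]

lemma pderiv_linSubst (B : Matrix ι ι K) (j : ι) (F : MvPolynomial ι K) :
    pderiv j (linSubst B F) = ∑ i, C (B i j) * linSubst B (pderiv i F) := by
  classical
  induction F using MvPolynomial.induction_on with
  | C a => simp [linSubst]
  | add p q h₁ h₂ => simp [h₁, h₂, mul_add, Finset.sum_add_distrib]
  | mul_X p k h =>
    have h1 : pderiv j (∑ l, C (B k l) * X l) = C (B k j) := by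
      simp [pderiv_X, Pi.single_apply]
    rw [map_mul, linSubst_X, Derivation.leibniz, h1, h]
    simp only [Derivation.leibniz, map_add, smul_eq_mul, map_mul, linSubst_X, pderiv_X, mul_add,
      Finset.sum_add_distrib, Pi.single_apply, apply_ite (linSubst B), map_zero, mul_ite,
      mul_one, mul_zero, Finset.sum_ite_eq, Finset.mem_univ, if_true]
    rw [Finset.mul_sum (s := Finset.univ) (a := ∑ l, C (B k l) * X l)]
    congr 1
    · exact mul_comm _ _
    · exact Finset.sum_congr rfl fun i _ => by ring

lemma isHomogeneous_linSubst (B : Matrix ι ι K) {d : ℕ} {F : MvPolynomial ι K}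
    (hF : F.IsHomogeneous d) : (linSubst B F).IsHomogeneous d := by
  simpa only [one_mul, linSubst] using hF.aeval (n := 1) _ fun i => isHomogeneous_linear _

lemma linSubst_linSubst (A B : Matrix ι ι K) (F : MvPolynomial ι K) :
    linSubst A (linSubst B F) = linSubst (B * A) F := by
  refine DFunLike.congr_fun (f := (linSubst A).comp (linSubst B)) (g := linSubst (B * A)) ?_ F
  refine MvPolynomial.algHom_ext fun i => ?_
  have h (a : K) : linSubst A (C a) = C a := by simp [linSubst]
  simp only [AlgHom.comp_apply, linSubst_X, map_sum, map_mul, h, Matrix.mul_apply, Finset.sum_mul,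
    Finset.mul_sum, mul_assoc]
  exact Finset.sum_comm

lemma linSubst_one [DecidableEq ι] (F : MvPolynomial ι K) :
    linSubst (1 : Matrix ι ι K) F = F := by
  have : linSubst (1 : Matrix ι ι K) = AlgHom.id K _ :=
    MvPolynomial.algHom_ext fun i => by simp [linSubst_X, Matrix.one_apply, apply_ite C, ite_mul]
  rw [this]; rfl

/-- A linear substitution, as an endomorphism of the space of forms of degree `d`. -/
def formSubst (d : ℕ) (B : Matrix ι ι K) (F : Forms ι K d) : Forms ι K d :=
  ⟨linSubst B F.1, isHomogeneous_linSubst B F.2⟩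

lemma gradAt_formSubst (d : ℕ) (B : Matrix ι ι K) (F : Forms ι K d) (x : ι → K) (j : ι) :
    gradAt d x j (formSubst d B F) = ∑ i, B i j * gradAt d (B.mulVec x) i F := by
  simp [gradAt_apply, formSubst, pderiv_linSubst, eval_linSubst]

omit [Fintype ι] in
lemma aeval_mul_of_isHomogeneous {A : Type*} [CommRing A] [Algebra K A] {d : ℕ}
    {F : MvPolynomial ι K} (hF : F.IsHomogeneous d) (c : A) (g : ι → A) :
    aeval (fun i => c * g i) F = c ^ d * aeval g F := by
  simp only [aeval_def, eval₂_eq, Finset.mul_sum]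
  refine Finset.sum_congr rfl fun a ha => ?_
  have h := hF (mem_support_iff.mp ha)
  have h' : ∑ i ∈ a.support, a i = d := by
    rw [← h]
    exact DFunLike.congr_fun Finsupp.degree_eq_weight_one a
  simp_rw [mul_pow, Finset.prod_mul_distrib, Finset.prod_pow_eq_pow_sum, h']
  ring

omit [Fintype ι] in
lemma eval_smul_of_isHomogeneous {d : ℕ} {F : MvPolynomial ι K} (hF : F.IsHomogeneous d) (c : K)
    (x : ι → K) : eval (c • x) F = c ^ d * eval x F := by
  simpa only [aeval_eq_eval] using! aeval_mul_of_isHomogeneous hF c x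

omit [Fintype ι] in
lemma gradAt_smul (d : ℕ) (c : K) (x : ι → K) (j : ι) (F : Forms ι K d) :
    gradAt d (c • x) j F = c ^ (d - 1) * gradAt d x j F := by
  simp only [gradAt_apply]
  exact eval_smul_of_isHomogeneous (IsHomogeneous.pderiv F.2) c x

lemma formSubst_vecMulVec (d : ℕ) (p t : ι → K) (F : Forms ι K d) :
    formSubst d (Matrix.vecMulVec p t) F = eval p F.1 • powForm d t := by
  ext1
  simp only [formSubst, powForm, Submodule.coe_smul]
  have h1 : linSubst (Matrix.vecMulVec p t) =
      aeval fun i => (∑ j, C (t j) * X j) * (C (p i) : MvPolynomial ι K) := by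
    refine MvPolynomial.algHom_ext fun i => ?_
    simp only [linSubst_X, Matrix.vecMulVec_apply, aeval_X, Finset.sum_mul, C_mul]
    exact Finset.sum_congr rfl fun j _ => by ring
  rw [h1, aeval_mul_of_isHomogeneous F.2, smul_eq_C_mul, mul_comm]
  congr 1
  exact aeval_algebraMap_apply (MvPolynomial ι K) p F.1

end Substitution

section Tangent

variable {K : Type*} [Field K] {ι : Type*} [Fintype ι]

/-- The span of the partial derivatives at `q`. -/
def tang (d : ℕ) (q : ι → K) : Submodule K (Module.Dual K (Forms ι K d)) :=
  Submodule.span K (Set.range (gradAt d q))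

/-- The span of the partial derivatives at the points with indices in `I`. -/
def tangs (d : ℕ) (I : Finset ℕ) (x : ℕ × ι → K) : Submodule K (Module.Dual K (Forms ι K d)) :=
  Submodule.span K (Set.range fun a : I × ι => gradAt d (fun j => x (a.1, j)) a.2)

omit [Fintype ι] in
lemma tangs_eq_iSup (d : ℕ) (I : Finset ℕ) (x : ℕ × ι → K) :
    tangs d I x = ⨆ i ∈ I, tang d (fun j => x (i, j)) := by
  simp only [tangs, tang, ← Submodule.span_iUnion]
  congr 1
  ext v
  simp [eq_comm]

omit [Fintype ι] in
lemma tangs_congr (d : ℕ) {I : Finset ℕ} {x y : ℕ × ι → K} (h : ∀ i ∈ I, ∀ j, x (i, j) = y (i, j)) :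
    tangs d I x = tangs d I y := by
  simp only [tangs_eq_iSup]
  refine iSup_congr fun i => iSup_congr fun hi => ?_
  simp [h i hi]

omit [Fintype ι] in
lemma tangs_insert (d : ℕ) (i : ℕ) (I : Finset ℕ) (x : ℕ × ι → K) :
    tangs d (insert i I) x = tang d (fun j => x (i, j)) ⊔ tangs d I x := by
  simp only [tangs_eq_iSup]
  exact Finset.iSup_insert _ _ _

omit [Fintype ι] in
lemma tangs_mono (d : ℕ) {I J : Finset ℕ} (h : I ⊆ J) (x : ℕ × ι → K) :
    tangs d I x ≤ tangs d J x := by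
  simp only [tangs_eq_iSup]
  exact biSup_mono fun i hi => h hi

lemma isPolyFun_tangs (d : ℕ) (I : Finset ℕ) (a : I × ι)
    (φ : Module.Dual K (Module.Dual K (Forms ι K d))) :
    IsPolyFun fun x : ℕ × ι → K => φ (gradAt d (fun j => x (a.1, j)) a.2) :=
  isPolyFun_dual (L := fun x : ℕ × ι → K => gradAt d (fun j => x (a.1, j)) a.2)
    (fun F => isPolyFun_gradAt d (q := fun x j => x ((a.1 : ℕ), j)) (fun _ => IsPolyFun.coord _)
      a.2 F) φ

/-- A functional lying in the span of the partial derivatives at general points is zero, unless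
these already span everything. -/
lemma eq_zero_of_eventually_mem_tangs [CharZero K] [DecidableEq ι] (d : ℕ) (I : Finset ℕ)
    {v : Module.Dual K (Forms ι K d)}
    (hv : ∀ᶠ x in generic (ℕ × ι) K, v ∈ tangs d I x)
    (hI : ∀ᶠ x in generic (ℕ × ι) K, tangs d I x ≠ ⊤) : v = 0 := by
  obtain ⟨g, hg, hgv⟩ := eventually_generic.mp hv
  obtain ⟨x₀, hgx, htop⟩ :
      ∃ x₀, eval x₀ g ≠ 0 ∧ tangs d I x₀ ≠ ⊤ := by
    obtain ⟨x₀, h1, h2⟩ := (hI.and (⟨g, hg, fun _ h => h⟩ :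
      ∀ᶠ x in generic (ℕ × ι) K, eval x g ≠ 0)).exists
    exact ⟨x₀, h2, h1⟩
  have hvx := hgv x₀ hgx
  obtain ⟨F, hF, hF0⟩ : ∃ F : Forms ι K d,
      (∀ a : I × ι, gradAt d (fun j => x₀ (a.1, j)) a.2 F = 0) ∧ F ≠ 0 := by
    have h1 := finrank_span_add_finrank_commonKer
      (fun a : I × ι => gradAt d (fun j => x₀ (a.1, j)) a.2)
    have h2 : Module.finrank K (tangs d I x₀) < Module.finrank K (Forms ι K d) := by
      rw [← Subspace.dual_finrank_eq (K := K) (V := Forms ι K d)]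
      exact Submodule.finrank_lt htop
    have h3 : 0 < Module.finrank K
        (commonKer fun a : I × ι => gradAt d (fun j => x₀ (a.1, j)) a.2) := by
      change Module.finrank K (tangs d I x₀) + _ = _ at h1
      omega
    obtain ⟨F, hF, hF0⟩ := Submodule.exists_mem_ne_zero_of_ne_bot
      (p := commonKer fun a : I × ι => gradAt d (fun j => x₀ (a.1, j)) a.2)
      (fun h => by rw [h, finrank_bot] at h3; exact h3.false)
    exact ⟨F, mem_commonKer.mp hF, hF0⟩
  have hpoly : IsPolyFun fun B : ι × ι → K =>
      v (formSubst d (Matrix.of fun i j => B (i, j)) F) := by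
    rw [tangs, Submodule.mem_span_range_iff_exists_fun] at hvx
    obtain ⟨c, rfl⟩ := hvx
    simp only [LinearMap.sum_apply, LinearMap.smul_apply, gradAt_formSubst, smul_eq_mul,
      Matrix.of_apply]
    refine IsPolyFun.sum _ fun a => IsPolyFun.mul (IsPolyFun.const _) (IsPolyFun.sum _ fun i =>
      IsPolyFun.mul (IsPolyFun.coord _) (isPolyFun_gradAt d (fun k => ?_) _ _))
    simp only [Matrix.mulVec, dotProduct, Matrix.of_apply]
    exact IsPolyFun.sum _ fun j => IsPolyFun.mul (IsPolyFun.coord _) (IsPolyFun.const _)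
  have hadj : ∀ᶠ B in generic (ι × ι) K, v ∈ tangs d I (fun a =>
      (Matrix.of fun i j => B (i, j)).adjugate.mulVec (fun j => x₀ (a.1, j)) a.2) := by
    refine eventually_generic_comp (Q := fun x => v ∈ tangs d I x) (p := g) hgv
      (x₀ := fun a => (1 : Matrix ι ι K) a.1 a.2) (fun a => ?_) ?_
    · simp only [Matrix.mulVec, dotProduct]
      exact IsPolyFun.sum _ fun j => IsPolyFun.mul
        (IsPolyFun.adjugate (f := fun i j (B : ι × ι → K) => B (i, j))
          (fun _ _ => IsPolyFun.coord _) _ _) (IsPolyFun.const _)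
    · have : (Matrix.of fun i j => (1 : Matrix ι ι K) i j) = 1 := rfl
      simpa [this] using hgx
  have hzero : ∀ᶠ B in generic (ι × ι) K,
      v (formSubst d (Matrix.of fun i j => B (i, j)) F) = 0 := by
    refine hadj.mono fun B hB => ?_
    rw [tangs, Submodule.mem_span_range_iff_exists_fun] at hB
    obtain ⟨c, rfl⟩ := hB
    simp only [LinearMap.sum_apply, LinearMap.smul_apply]
    refine Finset.sum_eq_zero fun a _ => ?_
    have h1 : ∀ i, gradAt d (fun j => x₀ (a.1, j)) i F = 0 := fun i => hF (a.1, i)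
    change c a • gradAt d (Matrix.mulVec (Matrix.of fun i j => B (i, j)).adjugate
      (fun j => x₀ (a.1, j))) a.2 _ = 0
    rw [gradAt_formSubst]
    simp [Matrix.mulVec_mulVec, Matrix.mul_adjugate, Matrix.smul_mulVec, gradAt_smul, h1]
  obtain ⟨p, hp⟩ : ∃ p, eval p F.1 ≠ 0 := by
    by_contra! h
    exact hF0 (Subtype.ext (MvPolynomial.funext fun x => by simpa using h x))
  refine dual_eq_zero_of_powForm fun t => ?_
  have h1 := hpoly.eq_zero_of_eventually hzero fun ij => Matrix.vecMulVec p t ij.1 ij.2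
  have h2 : (Matrix.of fun i j => Matrix.vecMulVec p t i j) = Matrix.vecMulVec p t := rfl
  simp only [h2, formSubst_vecMulVec, map_smul, smul_eq_mul] at h1
  exact (mul_eq_zero.mp h1).resolve_left hp

end Tangent

section GenericRank

variable {K : Type*} [Field K] {ι : Type*} [Fintype ι]

omit [Fintype ι] in
lemma finrank_tangs_le_forms [Finite ι] (d : ℕ) (I : Finset ℕ) (x : ℕ × ι → K) :
    Module.finrank K (tangs d I x) ≤ Module.finrank K (Forms ι K d) := by
  rw [← Subspace.dual_finrank_eq (K := K) (V := Forms ι K d)]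
  exact Submodule.finrank_le _

lemma finrank_tangs_le_card (d : ℕ) (I : Finset ℕ) (x : ℕ × ι → K) :
    Module.finrank K (tangs d I x) ≤ I.card * Fintype.card ι := by
  have := finrank_range_le_card (R := K) fun a : I × ι => gradAt d (fun j => x (a.1, j)) a.2
  rw [Fintype.card_prod, Fintype.card_coe] at this
  exact this

variable (K ι) in
/-- The dimension of the span of the partial derivatives at `r` general points. -/
def tangRank (d r : ℕ) : ℕ :=
  sSup (Set.range fun x : ℕ × ι → K => Module.finrank K (tangs d (Finset.range r) x))

lemma bddAbove_tangRank (d r : ℕ) :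
    BddAbove (Set.range fun x : ℕ × ι → K => Module.finrank K (tangs d (Finset.range r) x)) :=
  ⟨_, by rintro _ ⟨x, rfl⟩; exact finrank_tangs_le_forms _ _ _⟩

omit [Fintype ι] in
lemma exists_finrank_tangs_eq (d : ℕ) {I J : Finset ℕ} (h : I.card = J.card) (x : ℕ × ι → K) :
    ∃ y : ℕ × ι → K, tangs d J y = tangs d I x := by
  classical
  obtain e := Finset.equivOfCardEq h.symm
  refine ⟨fun a => if h : a.1 ∈ J then x (e ⟨a.1, h⟩, a.2) else 0, ?_⟩
  have h1 : ∀ a : J × ι, gradAt d (fun j => (fun a : ℕ × ι => if h : a.1 ∈ J then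
      x (e ⟨a.1, h⟩, a.2) else 0) ((a.1 : ℕ), j)) a.2 =
      gradAt d (fun j => x (((e.prodCongr (Equiv.refl ι)) a).1, j))
        ((e.prodCongr (Equiv.refl ι)) a).2 := fun a => by simp
  unfold tangs
  simp only [h1]
  congr 1
  exact (e.prodCongr (Equiv.refl ι)).surjective.range_comp
    (fun a : I × ι => gradAt d (fun j => x (a.1, j)) a.2)

lemma finrank_tangs_le (d : ℕ) (I : Finset ℕ) (x : ℕ × ι → K) :
    Module.finrank K (tangs d I x) ≤ tangRank K ι d I.card := by
  obtain ⟨y, hy⟩ := exists_finrank_tangs_eq d (I := I) (J := Finset.range I.card) (by simp) x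
  rw [← hy]
  exact le_csSup (bddAbove_tangRank d _) ⟨y, rfl⟩

lemma exists_finrank_tangs (d : ℕ) (I : Finset ℕ) :
    ∃ x : ℕ × ι → K, Module.finrank K (tangs d I x) = tangRank K ι d I.card := by
  obtain ⟨x, hx⟩ := Nat.sSup_mem (Set.range_nonempty _)
    (bddAbove_tangRank (K := K) (ι := ι) d I.card)
  obtain ⟨y, hy⟩ := exists_finrank_tangs_eq d (I := Finset.range I.card) (J := I)
    (Finset.card_range _) x
  exact ⟨y, by rw [hy]; exact hx⟩

lemma eventually_finrank_tangs (d : ℕ) (I : Finset ℕ) :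
    ∀ᶠ x in generic (ℕ × ι) K, Module.finrank K (tangs d I x) = tangRank K ι d I.card := by
  obtain ⟨x₀, hx₀⟩ := exists_finrank_tangs (K := K) (ι := ι) d I
  refine (eventually_le_finrank_span (v := fun (a : I × ι) (x : ℕ × ι → K) =>
    gradAt d (fun j => x (a.1, j)) a.2) (fun a => isPolyFun_tangs d I a) (x₀ := x₀)
    (r := tangRank K ι d I.card) hx₀.ge).mono fun x hx => ?_
  exact (finrank_tangs_le d I x).antisymm hx

lemma eventually_forall_finrank_tangs (d n : ℕ) :
    ∀ᶠ x in generic (ℕ × ι) K, ∀ I ⊆ Finset.range n,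
      Module.finrank K (tangs d I x) = tangRank K ι d I.card := by
  have : ∀ᶠ x in generic (ℕ × ι) K, ∀ I ∈ (Finset.range n).powerset,
      Module.finrank K (tangs d I x) = tangRank K ι d I.card :=
    (Filter.eventually_all_finset _).mpr fun I _ => eventually_finrank_tangs d I
  simpa using this

lemma tangRank_le_forms (d r : ℕ) : tangRank K ι d r ≤ Module.finrank K (Forms ι K d) := by
  obtain ⟨x, hx⟩ := exists_finrank_tangs (K := K) (ι := ι) d (Finset.range r)
  rw [Finset.card_range] at hx
  exact hx ▸ finrank_tangs_le_forms _ _ _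

lemma tangRank_le_mul (d r : ℕ) : tangRank K ι d r ≤ r * Fintype.card ι := by
  obtain ⟨x, hx⟩ := exists_finrank_tangs (K := K) (ι := ι) d (Finset.range r)
  rw [Finset.card_range] at hx
  simpa [hx] using finrank_tangs_le_card d (Finset.range r) x

lemma tangRank_zero (d : ℕ) : tangRank K ι d 0 = 0 := by
  simpa using tangRank_le_mul (K := K) (ι := ι) d 0

lemma tangRank_one [CharZero K] [DecidableEq ι] {d : ℕ} (hd : d ≠ 0) :
    tangRank K ι d 1 = Fintype.card ι := by
  refine (by simpa using tangRank_le_mul (K := K) (ι := ι) d 1 : _ ≤ _).antisymm ?_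
  rcases isEmpty_or_nonempty ι with h | ⟨⟨i₀⟩⟩
  · simp
  refine le_trans ?_ (finrank_tangs_le d {0} (fun a => (Pi.single i₀ 1 : ι → K) a.2))
  have hli : LinearIndependent K (gradAt (K := K) d (Pi.single i₀ 1)) := by
    rw [Fintype.linearIndependent_iff]
    intro c hc k
    by_cases hk : k = i₀
    · have h1 := LinearMap.congr_fun hc ⟨X i₀ ^ d, by simpa using (isHomogeneous_X K i₀).pow d⟩
      simp only [LinearMap.sum_apply, LinearMap.smul_apply, gradAt_apply,
        Derivation.leibniz_pow, pderiv_X] at h1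
      simpa [Pi.single_apply, apply_ite (eval _), hd, hk] using h1
    · have h1 := LinearMap.congr_fun hc ⟨X i₀ ^ (d - 1) * X k, by
        have := ((isHomogeneous_X K i₀).pow (d - 1)).mul (isHomogeneous_X K k)
        rwa [show 1 * (d - 1) + 1 = d by omega] at this⟩
      simp only [LinearMap.sum_apply, LinearMap.smul_apply, gradAt_apply, Derivation.leibniz,
        Derivation.leibniz_pow, pderiv_X] at h1
      simpa [Pi.single_apply, apply_ite (eval _), hk] using h1
  have h2 := finrank_span_eq_card hli
  rw [← h2]
  have h3 : tangs d {0} (fun a : ℕ × ι => (Pi.single i₀ 1 : ι → K) a.2) =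
      tang d (Pi.single i₀ 1) := by
    simp [tangs_eq_iSup]
  rw [h3]; rfl

/-- The generic rank is a concave function of the number of points. -/
lemma tangRank_concave [CharZero K] (d r : ℕ) :
    tangRank K ι d (r + 2) + tangRank K ι d r ≤ 2 * tangRank K ι d (r + 1) := by
  obtain ⟨x, hx⟩ := (eventually_forall_finrank_tangs (K := K) (ι := ι) d (r + 2)).exists
  have h0 := hx (Finset.range r) (by intro a; simp; omega)
  have h1 := hx (Finset.range (r + 1)) (by intro a; simp; omega)
  have h2 := hx (Finset.range (r + 2)) subset_rfl
  have hr : (r + 1) ∉ Finset.range r := by simp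
  have h1' := hx (insert (r + 1) (Finset.range r)) (by intro a; simp; omega)
  rw [Finset.card_insert_of_notMem hr] at h1'
  simp only [Finset.card_range] at h0 h1 h2 h1'
  have hs := Submodule.finrank_sup_add_finrank_inf_eq (tangs d (Finset.range (r + 1)) x)
    (tangs d (insert (r + 1) (Finset.range r)) x)
  have hsup : tangs d (Finset.range (r + 1)) x ⊔ tangs d (insert (r + 1) (Finset.range r)) x =
      tangs d (Finset.range (r + 2)) x := by
    rw [Finset.range_add_one (n := r + 1), tangs_insert d (r + 1) (Finset.range (r + 1)),
      tangs_insert d (r + 1) (Finset.range r), sup_left_comm,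
      sup_eq_left.mpr (tangs_mono d (Finset.range_subset_range.mpr (Nat.le_succ r)) x)]
  have hinf : tangs d (Finset.range r) x ≤
      tangs d (Finset.range (r + 1)) x ⊓ tangs d (insert (r + 1) (Finset.range r)) x :=
    le_inf (tangs_mono d (Finset.range_subset_range.mpr (Nat.le_succ r)) x)
      (tangs_mono d (Finset.subset_insert _ _) x)
  have := Submodule.finrank_mono hinf
  rw [hsup] at hs
  omega

end GenericRank

section GenericRank

variable {K : Type*} [Field K] [CharZero K] {ι : Type*} [Fintype ι] [DecidableEq ι]

/-- If the generic rank grows linearly for two steps, before reaching its maximum, then it grows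
as fast as possible. -/
lemma tangRank_add_of_eq (d r : ℕ) (hr : tangRank K ι d r < Module.finrank K (Forms ι K d))
    (h : tangRank K ι d (r + 2) + tangRank K ι d r = 2 * tangRank K ι d (r + 1)) :
    tangRank K ι d (r + 1) = tangRank K ι d r + tangRank K ι d 1 := by
  have hA := eventually_forall_finrank_tangs (K := K) (ι := ι) d (2 * r + 1)
  have hinf {x : ℕ × ι → K} (hx : ∀ I ⊆ Finset.range (2 * r + 1),
      Module.finrank K (tangs d I x) = tangRank K ι d I.card) {I : Finset ℕ}
      (hI : I ⊆ Finset.range (2 * r)) :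
      tangRank K ι d (I.card + 1) +
        Module.finrank K ↥(tang d (fun j => x (2 * r, j)) ⊓ tangs d I x) =
      tangRank K ι d 1 + tangRank K ι d I.card := by
    have hn : 2 * r ∉ I := fun hr => by simpa using hI hr
    have hI' : I ⊆ Finset.range (2 * r + 1) :=
      hI.trans (Finset.range_subset_range.mpr (Nat.le_succ _))
    have h1 := hx (insert (2 * r) I) (Finset.insert_subset (by simp) hI')
    have h2 := hx I hI'
    have h3 := hx {2 * r} (by simp)
    have h4 : tangs d {2 * r} x = tang d (fun j => x (2 * r, j)) := by simp [tangs_eq_iSup]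
    rw [Finset.card_insert_of_notMem hn, tangs_insert] at h1
    rw [Finset.card_singleton, h4] at h3
    have := Submodule.finrank_sup_add_finrank_inf_eq (tang d (fun j => x (2 * r, j))) (tangs d I x)
    omega
  have heq {x : ℕ × ι → K} (hx : ∀ I ⊆ Finset.range (2 * r + 1),
      Module.finrank K (tangs d I x) = tangRank K ι d I.card) {I J : Finset ℕ} (hIJ : I ⊆ J)
      (hJ : J ⊆ Finset.range (2 * r)) (hIc : I.card = r) (hJc : J.card = r + 1) :
      tang d (fun j => x (2 * r, j)) ⊓ tangs d I x =
        tang d (fun j => x (2 * r, j)) ⊓ tangs d J x := by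
    refine Submodule.eq_of_le_of_finrank_eq (inf_le_inf_left _ (tangs_mono d hIJ x)) ?_
    have h1 := hinf hx (hIJ.trans hJ)
    have h2 := hinf hx hJ
    rw [hIc] at h1
    rw [hJc, show r + 1 + 1 = r + 2 from rfl] at h2
    omega
  have hP {x : ℕ × ι → K} (hx : ∀ I ⊆ Finset.range (2 * r + 1),
      Module.finrank K (tangs d I x) = tangRank K ι d I.card) :
      tang d (fun j => x (2 * r, j)) ⊓ tangs d (Finset.range r) x =
        tang d (fun j => x (2 * r, j)) ⊓ tangs d (Finset.Ico r (2 * r)) x := by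
    have h1 : ∀ k ≤ r, tang d (fun j => x (2 * r, j)) ⊓ tangs d (Finset.range r) x =
        tang d (fun j => x (2 * r, j)) ⊓ tangs d (Finset.Ico k (k + r)) x := by
      intro k
      induction k with
      | zero => simp
      | succ k ih =>
        intro hk
        rw [ih (by omega)]
        have hsub : Finset.Ico k (k + r + 1) ⊆ Finset.range (2 * r) := by
          intro a; simp only [Finset.mem_Ico, Finset.mem_range]; omega
        rw [heq hx (J := Finset.Ico k (k + r + 1)) (Finset.Ico_subset_Ico le_rfl (by omega)) hsub
          (by simp) (by rw [Nat.card_Ico]; omega),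
          heq hx (J := Finset.Ico k (k + r + 1)) (I := Finset.Ico (k + 1) (k + 1 + r))
          (Finset.Ico_subset_Ico (by omega) (by omega)) hsub (by simp)
          (by rw [Nat.card_Ico]; omega)]
    have := h1 r le_rfl
    rwa [← two_mul] at this
  obtain ⟨g, hg, hgP⟩ := eventually_generic.mp (hA.mono fun x hx => hP hx)
  obtain ⟨x₀, hx₀, hgx₀⟩ := (hA.and (⟨g, hg, fun _ h => h⟩ :
    ∀ᶠ x in generic (ℕ × ι) K, eval x g ≠ 0)).exists
  have hbot : tang d (fun j => x₀ (2 * r, j)) ⊓ tangs d (Finset.range r) x₀ = ⊥ := by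
    rw [eq_bot_iff]
    intro v hv
    refine eq_zero_of_eventually_mem_tangs d (Finset.Ico r (2 * r)) ?_ ?_
    · have h1 := eventually_generic_comp (σ := ℕ × ι) hgP (x₀ := x₀)
        (g := fun a x => if a.1 ∈ Finset.Ico r (2 * r) then x a else x₀ a) (fun a => by
          by_cases ha : a.1 ∈ Finset.Ico r (2 * r)
          · simpa only [ha, if_true] using IsPolyFun.coord a
          · simpa only [ha, if_false] using IsPolyFun.const (x₀ a)) (by simpa using hgx₀)
      refine h1.mono fun x hx => ?_
      rw [tangs_congr d (y := x₀) fun i hi j => by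
        rw [if_neg (by simp only [Finset.mem_range] at hi; simp; omega)]] at hx
      simp only [Finset.mem_Ico, lt_irrefl, and_false, if_false] at hx
      rw [hx, tangs_congr d (y := x) fun i hi j => by
        rw [if_pos (by simpa using hi)]] at hv
      exact hv.2
    · refine (eventually_finrank_tangs d (Finset.Ico r (2 * r))).mono fun x hx htop => ?_
      rw [htop, finrank_top, Subspace.dual_finrank_eq, Nat.card_Ico,
        show 2 * r - r = r by omega] at hx
      omega
  have := hinf hx₀ (I := Finset.range r) (Finset.range_subset_range.mpr (by omega))
  rw [hbot, finrank_bot, Finset.card_range] at this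
  omega

omit [CharZero K] [DecidableEq ι] in
lemma tangRank_le_succ (d r : ℕ) : tangRank K ι d r ≤ tangRank K ι d (r + 1) := by
  obtain ⟨x, hx⟩ := exists_finrank_tangs (K := K) (ι := ι) d (Finset.range r)
  have h1 := finrank_tangs_le d (Finset.range (r + 1)) x
  have h2 := Submodule.finrank_mono
    (tangs_mono d (Finset.range_subset_range.mpr (Nat.le_add_right r 1)) x)
  simp only [Finset.card_range] at h1 hx
  omega

/-- The growth of the generic rank bounds its distance to the maximum. -/
lemma finrank_forms_le_tangRank_add {d : ℕ} (hd : d ≠ 0) (e : ℕ) (he : e < Fintype.card ι) (r : ℕ)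
    (h : tangRank K ι d (r + 1) ≤ tangRank K ι d r + e) :
    Module.finrank K (Forms ι K d) ≤ tangRank K ι d r + (e + 1).choose 2 := by
  have h1 := tangRank_one (K := K) (ι := ι) hd
  induction e generalizing r with
  | zero =>
    by_contra! hlt
    have h2 := tangRank_concave (K := K) (ι := ι) d r
    have h3 := tangRank_le_succ (K := K) (ι := ι) d r
    have h4 := tangRank_le_succ (K := K) (ι := ι) d (r + 1)
    have h5 := tangRank_add_of_eq (K := K) (ι := ι) d r (by omega)
      (by rw [show r + 1 + 1 = r + 2 from rfl] at h4; omega)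
    omega
  | succ e ih =>
    by_contra! hlt
    have h2 := tangRank_concave (K := K) (ι := ι) d r
    have h3 := tangRank_add_of_eq (K := K) (ι := ι) d r (by omega)
    have h4 := ih (by omega) (r + 1)
    rw [show r + 1 + 1 = r + 2 from rfl] at h4
    rw [Nat.choose_succ_succ' (e + 1) 1, Nat.choose_one_right] at hlt
    have h5 : (1 + 1 : ℕ) = 2 := rfl
    rw [h5] at hlt
    omega

/-- In degree at least four, many general double points impose independent conditions. -/
lemma exists_linearIndependent_gradAt_of_four_le {d : ℕ} (hd : 4 ≤ d) (hι : 2 ≤ Fintype.card ι) :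
    ∃ (T : ℕ) (x : Fin T → ι → K),
      LinearIndependent K (fun a : Fin T × ι => gradAt d (x a.1) a.2) ∧
      Module.finrank K (Forms ι K d) ≤ T * (Fintype.card ι + 1) := by
  classical
  set M := Fintype.card ι with hM
  have hex : ∃ t, tangRank K ι d (t + 1) ≠ (t + 1) * M := by
    by_contra! h
    have h1 := h (Module.finrank K (Forms ι K d))
    have h2 := tangRank_le_forms (K := K) (ι := ι) d (Module.finrank K (Forms ι K d) + 1)
    nlinarith
  set T := Nat.find hex with hT
  have hT1 : tangRank K ι d (T + 1) ≠ (T + 1) * M := Nat.find_spec hex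
  have hT0 : tangRank K ι d T = T * M := by
    rcases Nat.eq_zero_or_pos T with h | h
    · rw [h, tangRank_zero, zero_mul]
    · have := Nat.find_min hex (m := T - 1) (by omega)
      rw [not_not, show T - 1 + 1 = T by omega] at this
      exact this
  have hT2 := tangRank_le_mul (K := K) (ι := ι) d (T + 1)
  have hT3 : tangRank K ι d (T + 1) ≤ tangRank K ι d T + (M - 1) := by
    rw [← hM] at hT2
    rw [add_mul, one_mul] at hT1 hT2
    omega
  have hN := finrank_forms_le_tangRank_add (K := K) (ι := ι) (d := d) (by omega) (M - 1)
    (by omega) T hT3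
  obtain ⟨x, hx⟩ := exists_finrank_tangs (K := K) (ι := ι) d (Finset.range T)
  refine ⟨T, fun i j => x (i, j), ?_, ?_⟩
  · have hli : LinearIndependent K (fun a : Finset.range T × ι =>
        gradAt d (fun j => x (a.1, j)) a.2) := by
      rw [linearIndependent_iff_card_eq_finrank_span]
      rw [Finset.card_range, hT0] at hx
      rw [Fintype.card_prod, Fintype.card_coe, Finset.card_range]
      exact hx.symm
    refine hli.comp (fun a : Fin T × ι => (⟨a.1, by simp⟩, a.2)) fun a b hab => ?_
    simp only [Prod.mk.injEq, Subtype.mk.injEq] at hab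
    exact Prod.ext (Fin.ext hab.1) hab.2
  · have h1 : (M + 1) * M.choose 2 ≤ Module.finrank K (Forms ι K d) := by
      rw [finrank_forms, ← hM]
      have h2 : (M + 3).choose 4 ≤ (M + d - 1).choose d := by
        rw [← Nat.choose_symm (by omega : 4 ≤ M + 3), ← Nat.choose_symm (by omega : d ≤ M + d - 1),
          show M + 3 - 4 = M - 1 by omega, show M + d - 1 - d = M - 1 by omega]
        exact Nat.choose_le_choose _ (by omega)
      refine le_trans ?_ h2
      obtain ⟨a, ha⟩ : ∃ a, M = a + 2 := ⟨M - 2, by omega⟩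
      rw [ha]
      have h3 := Nat.triangle_succ (a + 1)
      have h4 := Nat.ascFactorial_eq_factorial_mul_choose (a + 1) 4
      have h5 := Nat.ascFactorial_eq_factorial_mul_choose a 2
      simp only [Nat.ascFactorial, Nat.factorial] at h4 h5
      rw [show a + 1 + 4 = a + 2 + 3 by ring] at h4
      nlinarith [sq_nonneg ((a : ℤ) - 1)]
    rw [show M - 1 + 1 = M by omega, hT0] at hN
    have h2 : M.choose 2 ≤ T := by
      have : M * M.choose 2 ≤ M * T := by linarith
      exact Nat.le_of_mul_le_mul_left this (by omega)
    rw [mul_add, mul_one]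
    omega

end GenericRank

section Blocks

variable {K : Type*} [Field K]

/-- The matrix form of the independence of the conditions imposed on cubic forms by double points
at the `q p`. -/
def CubicIndep {A ι : Type*} [Fintype A] (q : A → ι → K) : Prop :=
  ∀ c : A → ι → K, (∀ x y z, ∑ p, (c p x * q p y * q p z + c p y * q p x * q p z +
    c p z * q p x * q p y) = 0) → ∀ p x, c p x = 0

lemma CubicIndep.linearIndependent {A ι : Type*} [Fintype A] [Fintype ι] {q : A → ι → K}
    (h : CubicIndep q) : LinearIndependent K (fun a : A × ι => gradAt 3 (q a.1) a.2) := by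
  classical
  rw [Fintype.linearIndependent_iff]
  intro c hc
  suffices ∀ p x, c (p, x) = 0 from fun a => this a.1 a.2
  refine h (fun p x => c (p, x)) fun x y z => ?_
  have h1 := LinearMap.congr_fun hc ⟨X x * X y * X z,
    ((isHomogeneous_X K x).mul (isHomogeneous_X K y)).mul (isHomogeneous_X K z)⟩
  simp only [LinearMap.sum_apply, LinearMap.smul_apply, gradAt_apply, Derivation.leibniz,
    pderiv_X, smul_eq_mul, LinearMap.zero_apply] at h1
  rw [← h1, Fintype.sum_prod_type]
  refine Finset.sum_congr rfl fun p _ => ?_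
  simp only [Pi.single_apply, map_add, map_mul, eval_X, apply_ite (eval (q p)), map_zero,
    mul_add, mul_ite, mul_one, mul_zero, Finset.sum_add_distrib, Finset.sum_ite_eq,
    Finset.mem_univ, if_true]
  ring

lemma CubicIndep.comp_equiv {A ι ι' : Type*} [Fintype A] {q : A → ι → K}
    (h : CubicIndep q) (e : ι' ≃ ι) : CubicIndep (fun p x => q p (e x)) := by
  intro c hc p x
  have := h (fun p x => c p (e.symm x)) (fun x y z => by
    simpa using hc (e.symm x) (e.symm y) (e.symm z)) p (e x)
  simpa using this

lemma CubicIndep.reindex {A B ι : Type*} [Fintype A] [Fintype B] {q : A → ι → K}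
    (h : CubicIndep q) (e : B ≃ A) : CubicIndep (fun p x => q (e p) x) := by
  intro c hc p x
  have := h (fun p x => c (e.symm p) x) (fun x y z => by
    rw [← hc x y z, ← e.sum_comp]; simp) (e p) x
  simpa using this

/-- Nondegeneracy of the interaction of three blocks of coordinates, of sizes `p`, `q`, `r`. -/
def TripleCond (p q r : ℕ) (w x w' y u v : ℕ → ℕ → K) : Prop :=
  ∀ (f : Fin p → Fin r → K) (g : Fin p → Fin q → K) (h : Fin q → Fin p → K),
    (∀ (a : Fin p) (b : Fin q) (c : Fin r), ∑ l : Fin p, f l c * w l a * x l b +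
      ∑ l : Fin p, g l b * w' l a * y l c + ∑ l : Fin q, h l a * u l b * v l c = 0) →
    f = 0 ∧ g = 0 ∧ h = 0

/-- Nondegeneracy of the interaction of two blocks of coordinates, of sizes `p`, `q`. -/
def PairCond (p q : ℕ) (D : Set (Fin p)) (w x : ℕ → ℕ → K) : Prop :=
  ∀ (f : Fin p → Fin p → K) (g : Fin p → Fin q → K),
    (∀ (a a' : Fin p) (b : Fin q), (a = a' → a ∈ D) → ∑ l : Fin p,
      (f l a * w l a' * x l b + f l a' * w l a * x l b + g l b * w l a * w l a') = 0) →
    (∀ (a : Fin p) (b b' : Fin q), b ≠ b' → ∑ l : Fin p,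
      (f l a * x l b * x l b' + g l b * w l a * x l b' + g l b' * w l a * x l b) = 0) →
    f = 0 ∧ g = 0

variable {β : Type*} [Fintype β] [LinearOrder β] (b : β → ℕ)

/-- The index set of the points of the block configuration: coordinate points, and points supported
on two blocks. -/
abbrev BlockPoints (D : Set (Σ i, Fin (b i))) : Type _ :=
  {s : Σ i, Fin (b i) // s ∉ D} ⊕ (Σ e : {e : β × β // e.1 < e.2}, Fin (b e.1.1))

/-- The points supported on two blocks. -/
def edgePoint (w x : β → β → ℕ → ℕ → K) (e : β × β) (l : ℕ) (s : Σ i, Fin (b i)) : K :=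
  if s.1 = e.1 then w e.1 e.2 l s.2 else if s.1 = e.2 then x e.1 e.2 l s.2 else 0

/-- The points of the block configuration. -/
def blockPoint (D : Set (Σ i, Fin (b i))) (w x : β → β → ℕ → ℕ → K) :
    BlockPoints b D → (Σ i, Fin (b i)) → K
  | .inl s, t => if t = s then 1 else 0
  | .inr p, t => edgePoint b w x p.1.1 p.2 t

variable {b}

omit [Fintype β] in
lemma edgePoint_fst (w x : β → β → ℕ → ℕ → K) {i j : β} (l : ℕ) (a : Fin (b i)) :
    edgePoint b w x (i, j) l ⟨i, a⟩ = w i j l a := by simp [edgePoint]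

omit [Fintype β] in
lemma edgePoint_snd (w x : β → β → ℕ → ℕ → K) {i j : β} (h : i < j) (l : ℕ) (a : Fin (b j)) :
    edgePoint b w x (i, j) l ⟨j, a⟩ = x i j l a := by simp [edgePoint, h.ne']

omit [Fintype β] in
lemma edgePoint_eq_zero (w x : β → β → ℕ → ℕ → K) {e : β × β} (l : ℕ) {s : Σ i, Fin (b i)}
    (h1 : s.1 ≠ e.1) (h2 : s.1 ≠ e.2) : edgePoint b w x e l s = 0 := by simp [edgePoint, h1, h2]

omit [Fintype β] in
lemma edgePoint_mul_eq_zero (w x : β → β → ℕ → ℕ → K) {e : β × β} (he : e.1 < e.2) (l : ℕ)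
    {i j : β} (hij : i < j) (hne : e ≠ (i, j)) (a : Fin (b i)) (a' : Fin (b j)) :
    edgePoint b w x e l ⟨i, a⟩ * edgePoint b w x e l ⟨j, a'⟩ = 0 := by
  by_contra h
  obtain ⟨h1, h2⟩ := mul_ne_zero_iff.mp h
  have h1' : i = e.1 ∨ i = e.2 := by
    by_contra! hi; exact h1 (edgePoint_eq_zero w x l hi.1 hi.2)
  have h2' : j = e.1 ∨ j = e.2 := by
    by_contra! hi; exact h2 (edgePoint_eq_zero w x l hi.1 hi.2)
  rcases h1' with rfl | rfl <;> rcases h2' with rfl | rfl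
  · exact hij.false
  · exact hne rfl
  · exact he.not_gt hij
  · exact hij.false

lemma sum_edgePoint_mul (w x : β → β → ℕ → ℕ → K)
    (F : (Σ e : {e : β × β // e.1 < e.2}, Fin (b e.1.1)) → K) {i j : β} (hij : i < j)
    (a : Fin (b i)) (a' : Fin (b j)) :
    ∑ p, F p * (edgePoint b w x p.1.1 p.2 ⟨i, a⟩ * edgePoint b w x p.1.1 p.2 ⟨j, a'⟩) =
      ∑ l : Fin (b i), F ⟨⟨(i, j), hij⟩, l⟩ * (w i j l a * x i j l a') := by
  rw [Fintype.sum_sigma, Fintype.sum_eq_single ⟨(i, j), hij⟩]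
  · simp only [edgePoint_fst, edgePoint_snd w x hij]
  · intro e he
    refine Finset.sum_eq_zero fun l _ => ?_
    rw [edgePoint_mul_eq_zero w x e.2 _ hij (fun h => he (Subtype.ext h)), mul_zero]

/-- The block configuration imposes independent conditions on cubic forms. -/
lemma cubicIndep_blockPoint [CharZero K] (D : Set (Σ i, Fin (b i))) [DecidablePred (· ∈ D)]
    (w x : β → β → ℕ → ℕ → K)
    (hT : ∀ i j k, i < j → j < k → TripleCond (b i) (b j) (b k)
      (w i j) (x i j) (w i k) (x i k) (w j k) (x j k))
    (hP : ∀ i j, i < j → PairCond (b i) (b j) {a | ⟨i, a⟩ ∈ D} (w i j) (x i j)) :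
    CubicIndep (blockPoint b D w x) := by
  intro c hc
  have hcoord (s t u : Σ i, Fin (b i)) (h1 : s = t → s ∈ D) (h2 : s = u → s ∈ D)
      (h3 : t = u → t ∈ D) : ∑ p : {s : Σ i, Fin (b i) // s ∉ D},
        (c (.inl p) s * blockPoint b D w x (.inl p) t * blockPoint b D w x (.inl p) u +
        c (.inl p) t * blockPoint b D w x (.inl p) s * blockPoint b D w x (.inl p) u +
        c (.inl p) u * blockPoint b D w x (.inl p) s * blockPoint b D w x (.inl p) t) = 0 := by
    refine Finset.sum_eq_zero fun p _ => ?_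
    have h {t u : Σ i, Fin (b i)} (htu : t = u → t ∈ D) : 
        (if t = p.1 then (1 : K) else 0) * (if u = p.1 then 1 else 0) = 0 := by
      by_contra hne
      have h1 : t = p.1 := by by_contra h; simp [h] at hne
      have h2 : u = p.1 := by by_contra h; simp [h] at hne
      exact p.2 (h1 ▸ htu (h1.trans h2.symm))
    simp only [blockPoint, mul_assoc, h h1, h h2, h h3, mul_zero, add_zero]
  have hedge (s t u : Σ i, Fin (b i)) (h1 : s = t → s ∈ D) (h2 : s = u → s ∈ D)
      (h3 : t = u → t ∈ D) :
      ∑ p, c (.inr p) s * (edgePoint b w x p.1.1 p.2 t * edgePoint b w x p.1.1 p.2 u) +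
      ∑ p, c (.inr p) t * (edgePoint b w x p.1.1 p.2 s * edgePoint b w x p.1.1 p.2 u) +
      ∑ p, c (.inr p) u * (edgePoint b w x p.1.1 p.2 s * edgePoint b w x p.1.1 p.2 t) = 0 := by
    have := hc s t u
    rw [Fintype.sum_sum_type, hcoord s t u h1 h2 h3, zero_add] at this
    rw [← this, ← Finset.sum_add_distrib, ← Finset.sum_add_distrib]
    exact Finset.sum_congr rfl fun p _ => by simp only [blockPoint, mul_assoc]
  have hne {i j : β} (hij : i ≠ j) (a : Fin (b i)) (a' : Fin (b j)) :
      (⟨i, a⟩ : Σ i, Fin (b i)) ≠ ⟨j, a'⟩ := fun h => hij (congrArg Sigma.fst h)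
  have h3 (i j k : β) (hij : i < j) (hjk : j < k) :
      (∀ l a, c (.inr ⟨⟨(i, j), hij⟩, l⟩) ⟨k, a⟩ = 0) ∧
      (∀ l a, c (.inr ⟨⟨(i, k), hij.trans hjk⟩, l⟩) ⟨j, a⟩ = 0) ∧
      (∀ l a, c (.inr ⟨⟨(j, k), hjk⟩, l⟩) ⟨i, a⟩ = 0) := by
    have := hT i j k hij hjk (fun l a => c (.inr ⟨⟨(i, j), hij⟩, l⟩) ⟨k, a⟩)
      (fun l a => c (.inr ⟨⟨(i, k), hij.trans hjk⟩, l⟩) ⟨j, a⟩)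
      (fun l a => c (.inr ⟨⟨(j, k), hjk⟩, l⟩) ⟨i, a⟩) (fun a a' a'' => by
        have h := hedge ⟨i, a⟩ ⟨j, a'⟩ ⟨k, a''⟩ (fun h => (hne hij.ne _ _ h).elim)
          (fun h => (hne (hij.trans hjk).ne _ _ h).elim) (fun h => (hne hjk.ne _ _ h).elim)
        rw [sum_edgePoint_mul w x (fun p => c (.inr p) ⟨i, a⟩) hjk,
          sum_edgePoint_mul w x (fun p => c (.inr p) ⟨j, a'⟩) (hij.trans hjk),
          sum_edgePoint_mul w x (fun p => c (.inr p) ⟨k, a''⟩) hij] at h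
        simp only [mul_assoc]
        linear_combination h)
    refine ⟨fun l a => ?_, fun l a => ?_, fun l a => ?_⟩
    · exact congrFun (congrFun this.1 l) a
    · exact congrFun (congrFun this.2.1 l) a
    · exact congrFun (congrFun this.2.2 l) a
  have hthird (e : {e : β × β // e.1 < e.2}) (l : Fin (b e.1.1)) (k : β) (a : Fin (b k))
      (h1 : k ≠ e.1.1) (h2 : k ≠ e.1.2) : c (.inr ⟨e, l⟩) ⟨k, a⟩ = 0 := by
    obtain ⟨⟨i, j⟩, hij⟩ := e
    rcases lt_or_gt_of_ne h1 with h | h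
    · exact (h3 k i j h hij).2.2 l a
    · rcases lt_or_gt_of_ne h2 with h' | h'
      · exact (h3 i k j h h').2.1 l a
      · exact (h3 i j k hij h').1 l a
  have hsame {i j k k' : β} (hij : i < j) (hk : (k = i ∧ k' = j) ∨ (k = j ∧ k' = i))
      (a a' : Fin (b k)) (d : Fin (b k')) :
      ∑ p, c (.inr p) ⟨k', d⟩ *
        (edgePoint b w x p.1.1 p.2 ⟨k, a⟩ * edgePoint b w x p.1.1 p.2 ⟨k, a'⟩) =
      ∑ l, c (.inr ⟨⟨(i, j), hij⟩, l⟩) ⟨k', d⟩ * (edgePoint b w x (i, j) l ⟨k, a⟩ *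
        edgePoint b w x (i, j) l ⟨k, a'⟩) := by
    rw [Fintype.sum_sigma, Fintype.sum_eq_single ⟨(i, j), hij⟩]
    intro e he
    refine Finset.sum_eq_zero fun l _ => ?_
    by_cases hke : k = e.1.1 ∨ k = e.1.2
    · have hk' : k' ≠ e.1.1 ∧ k' ≠ e.1.2 := by
        obtain ⟨⟨i', j'⟩, hij'⟩ := e
        simp only [ne_eq, Subtype.mk.injEq, Prod.mk.injEq, not_and] at he hke hij' ⊢
        rcases hk with ⟨rfl, rfl⟩ | ⟨rfl, rfl⟩ <;> rcases hke with rfl | rfl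
        · exact ⟨hij.ne', fun h => he rfl h.symm⟩
        · exact ⟨fun h => (h ▸ hij').not_gt hij, hij.ne'⟩
        · exact ⟨hij.ne, fun h => (h ▸ hij').not_gt hij⟩
        · exact ⟨fun h => he h.symm rfl, hij.ne⟩
      rw [hthird e l k' d hk'.1 hk'.2, zero_mul]
    · push Not at hke
      rw [edgePoint_eq_zero w x l hke.1 hke.2, zero_mul, mul_zero]
  have h2 (i j : β) (hij : i < j) :
      (∀ l a, c (.inr ⟨⟨(i, j), hij⟩, l⟩) ⟨i, a⟩ = 0) ∧
      (∀ l a, c (.inr ⟨⟨(i, j), hij⟩, l⟩) ⟨j, a⟩ = 0) := by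
    have := hP i j hij (fun l a => c (.inr ⟨⟨(i, j), hij⟩, l⟩) ⟨i, a⟩)
      (fun l a => c (.inr ⟨⟨(i, j), hij⟩, l⟩) ⟨j, a⟩) (fun a a' d haa' => by
        have h := hedge ⟨i, a⟩ ⟨i, a'⟩ ⟨j, d⟩
          (fun h => haa' (eq_of_heq (Sigma.mk.inj h).2)) (fun h => (hne hij.ne _ _ h).elim)
          (fun h => (hne hij.ne _ _ h).elim)
        rw [sum_edgePoint_mul w x (fun p => c (.inr p) ⟨i, a⟩) hij,
          sum_edgePoint_mul w x (fun p => c (.inr p) ⟨i, a'⟩) hij,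
          hsame hij (Or.inl ⟨rfl, rfl⟩)] at h
        simp only [edgePoint_fst] at h
        simpa only [Finset.sum_add_distrib, mul_assoc] using h) (fun a d d' hdd' => by
        have h := hedge ⟨i, a⟩ ⟨j, d⟩ ⟨j, d'⟩ (fun h => (hne hij.ne _ _ h).elim)
          (fun h => (hne hij.ne _ _ h).elim) (fun h => (hdd' (eq_of_heq (Sigma.mk.inj h).2)).elim)
        rw [sum_edgePoint_mul w x (fun p => c (.inr p) ⟨j, d'⟩) hij,
          sum_edgePoint_mul w x (fun p => c (.inr p) ⟨j, d⟩) hij,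
          hsame hij (Or.inr ⟨rfl, rfl⟩)] at h
        simp only [edgePoint_snd w x hij] at h
        simpa only [Finset.sum_add_distrib, mul_assoc] using h)
    exact ⟨fun l a => congrFun (congrFun this.1 l) a, fun l a => congrFun (congrFun this.2 l) a⟩
  have hedge0 (p : Σ e : {e : β × β // e.1 < e.2}, Fin (b e.1.1)) (t : Σ i, Fin (b i)) :
      c (.inr p) t = 0 := by
    obtain ⟨⟨⟨i, j⟩, hij⟩, l⟩ := p
    obtain ⟨k, a⟩ := t
    by_cases hki : k = i
    · subst hki; exact (h2 k j hij).1 l a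
    by_cases hkj : k = j
    · subst hkj; exact (h2 i k hij).2 l a
    exact hthird _ l k a hki hkj
  have hc' (s t u : Σ i, Fin (b i)) : ∑ p : {s : Σ i, Fin (b i) // s ∉ D},
        (c (.inl p) s * blockPoint b D w x (.inl p) t * blockPoint b D w x (.inl p) u +
        c (.inl p) t * blockPoint b D w x (.inl p) s * blockPoint b D w x (.inl p) u +
        c (.inl p) u * blockPoint b D w x (.inl p) s * blockPoint b D w x (.inl p) t) = 0 := by
    have := hc s t u
    rw [Fintype.sum_sum_type] at this
    simpa [hedge0] using this
  rintro (p | p) t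
  · have h := hc' p.1 p.1 t
    rw [Fintype.sum_eq_single p] at h
    · by_cases ht : t = p.1
      · subst ht
        simp only [blockPoint, if_true, mul_one] at h
        have h3 : (3 : K) ≠ 0 := by norm_num
        exact (mul_eq_zero.mp (by linear_combination h : 3 * c (.inl p) p.1 = 0)).resolve_left h3
      · simpa [blockPoint, ht] using h
    · intro p' hp'
      have : p.1 ≠ p'.1 := fun h => hp' (Subtype.ext h.symm)
      simp [blockPoint, this]
  · exact hedge0 p t

end Blocks

section GenericBlocks

variable {K : Type*} [Field K]

section Eventually

variable {σ : Type*} {p q r : ℕ} {w x w' y u v : (σ → K) → ℕ → ℕ → K}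

lemma eventually_tripleCond (hw : ∀ a b, IsPolyFun fun θ => w θ a b)
    (hx : ∀ a b, IsPolyFun fun θ => x θ a b) (hw' : ∀ a b, IsPolyFun fun θ => w' θ a b)
    (hy : ∀ a b, IsPolyFun fun θ => y θ a b) (hu : ∀ a b, IsPolyFun fun θ => u θ a b)
    (hv : ∀ a b, IsPolyFun fun θ => v θ a b) {θ₀ : σ → K}
    (h : TripleCond p q r (w θ₀) (x θ₀) (w' θ₀) (y θ₀) (u θ₀) (v θ₀)) :
    ∀ᶠ θ in generic σ K, TripleCond p q r (w θ) (x θ) (w' θ) (y θ) (u θ) (v θ) := by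
  let L (s : Fin p × Fin q × Fin r) (θ : σ → K) : 
      Module.Dual K ((Fin p → Fin r → K) × (Fin p → Fin q → K) × (Fin q → Fin p → K)) :=
    { toFun := fun F => ∑ l : Fin p, F.1 l s.2.2 * w θ l s.1 * x θ l s.2.1 +
        ∑ l : Fin p, F.2.1 l s.2.1 * w' θ l s.1 * y θ l s.2.2 +
        ∑ l : Fin q, F.2.2 l s.1 * u θ l s.2.1 * v θ l s.2.2
      map_add' := fun F G => by
        simp only [Prod.fst_add, Prod.snd_add, Pi.add_apply, add_mul, Finset.sum_add_distrib]
        ring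
      map_smul' := fun c F => by
        simp only [Prod.smul_fst, Prod.smul_snd, Pi.smul_apply, smul_eq_mul, mul_assoc,
          ← Finset.mul_sum, ← mul_add, RingHom.id_apply] }
  have hiff (θ : σ → K) : TripleCond p q r (w θ) (x θ) (w' θ) (y θ) (u θ) (v θ) ↔
      Module.finrank K (commonKer fun s => L s θ) ≤ 0 := by
    rw [Nat.le_zero, Submodule.finrank_eq_zero, Submodule.eq_bot_iff]
    constructor
    · intro h F hF
      rw [mem_commonKer] at hF
      obtain ⟨h1, h2, h3⟩ := h F.1 F.2.1 F.2.2 fun a b c => hF (a, b, c)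
      exact Prod.ext h1 (Prod.ext h2 h3)
    · intro h f g k hF
      have := h (f, g, k) (mem_commonKer.mpr fun s => hF s.1 s.2.1 s.2.2)
      simpa only [Prod.mk_eq_zero] using this
  simp only [hiff] at h ⊢
  refine eventually_finrank_commonKer_le (fun s F => ?_) h
  exact ((IsPolyFun.sum _ fun l => ((IsPolyFun.const _).mul (hw _ _)).mul (hx _ _)).add
    (IsPolyFun.sum _ fun l => ((IsPolyFun.const _).mul (hw' _ _)).mul (hy _ _))).add
    (IsPolyFun.sum _ fun l => ((IsPolyFun.const _).mul (hu _ _)).mul (hv _ _))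

lemma eventually_pairCond {D : Set (Fin p)} (hw : ∀ a b, IsPolyFun fun θ => w θ a b)
    (hx : ∀ a b, IsPolyFun fun θ => x θ a b) {θ₀ : σ → K}
    (h : PairCond p q D (w θ₀) (x θ₀)) :
    ∀ᶠ θ in generic σ K, PairCond p q D (w θ) (x θ) := by
  let L (s : {s : Fin p × Fin p × Fin q // s.1 = s.2.1 → s.1 ∈ D} ⊕
      {s : Fin p × Fin q × Fin q // s.2.1 ≠ s.2.2}) (θ : σ → K) : 
      Module.Dual K ((Fin p → Fin p → K) × (Fin p → Fin q → K)) :=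
    Sum.elim (fun s =>
      { toFun := fun F => ∑ l : Fin p,
          (F.1 l s.1.1 * w θ l s.1.2.1 * x θ l s.1.2.2 +
            F.1 l s.1.2.1 * w θ l s.1.1 * x θ l s.1.2.2 +
            F.2 l s.1.2.2 * w θ l s.1.1 * w θ l s.1.2.1)
        map_add' := fun F G => by
          simp only [Prod.fst_add, Prod.snd_add, Pi.add_apply, add_mul, Finset.sum_add_distrib]
          ring
        map_smul' := fun c F => by
          simp only [Prod.smul_fst, Prod.smul_snd, Pi.smul_apply, smul_eq_mul, mul_assoc,
            ← Finset.mul_sum, ← mul_add, RingHom.id_apply] }) (fun s =>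
      { toFun := fun F => ∑ l : Fin p,
          (F.1 l s.1.1 * x θ l s.1.2.1 * x θ l s.1.2.2 +
            F.2 l s.1.2.1 * w θ l s.1.1 * x θ l s.1.2.2 +
            F.2 l s.1.2.2 * w θ l s.1.1 * x θ l s.1.2.1)
        map_add' := fun F G => by
          simp only [Prod.fst_add, Prod.snd_add, Pi.add_apply, add_mul, Finset.sum_add_distrib]
          ring
        map_smul' := fun c F => by
          simp only [Prod.smul_fst, Prod.smul_snd, Pi.smul_apply, smul_eq_mul, mul_assoc,
            ← Finset.mul_sum, ← mul_add, RingHom.id_apply] }) s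
  have hiff (θ : σ → K) : PairCond p q D (w θ) (x θ) ↔
      Module.finrank K (commonKer fun s => L s θ) ≤ 0 := by
    rw [Nat.le_zero, Submodule.finrank_eq_zero, Submodule.eq_bot_iff]
    constructor
    · intro h F hF
      rw [mem_commonKer] at hF
      obtain ⟨h1, h2⟩ := h F.1 F.2 (fun a b c h => hF (.inl ⟨(a, b, c), h⟩))
        (fun a b c h => hF (.inr ⟨(a, b, c), h⟩))
      exact Prod.ext h1 h2
    · intro h f g h1 h2
      have := h (f, g) (mem_commonKer.mpr (by
        rintro (s | s)
        · exact h1 s.1.1 s.1.2.1 s.1.2.2 s.2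
        · exact h2 s.1.1 s.1.2.1 s.1.2.2 s.2))
      simpa only [Prod.mk_eq_zero] using this
  simp only [hiff] at h ⊢
  refine eventually_finrank_commonKer_le (fun s F => ?_) h
  rcases s with s | s <;>
    simp only [L, Sum.elim_inl, Sum.elim_inr, LinearMap.coe_mk, AddHom.coe_mk]
  · exact IsPolyFun.sum _ fun l => ((((IsPolyFun.const _).mul (hw _ _)).mul (hx _ _)).add
      (((IsPolyFun.const _).mul (hw _ _)).mul (hx _ _))).add
      (((IsPolyFun.const _).mul (hw _ _)).mul (hw _ _))
  · exact IsPolyFun.sum _ fun l => ((((IsPolyFun.const _).mul (hx _ _)).mul (hx _ _)).add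
      (((IsPolyFun.const _).mul (hw _ _)).mul (hx _ _))).add
      (((IsPolyFun.const _).mul (hw _ _)).mul (hx _ _))

end Eventually

variable {β : Type*} [Fintype β] [LinearOrder β] {b : β → ℕ}

/-- If the pair and triple conditions can be satisfied separately, then they can be satisfied
simultaneously. -/
lemma exists_cubicIndep_blockPoint [CharZero K] (D : Set (Σ i, Fin (b i)))
    [DecidablePred (· ∈ D)]
    (hT : ∀ i j k, i < j → j < k → ∃ w x w' y u v : ℕ → ℕ → K,
      TripleCond (b i) (b j) (b k) w x w' y u v)
    (hP : ∀ i j, i < j → ∃ w x : ℕ → ℕ → K, PairCond (b i) (b j) {a | ⟨i, a⟩ ∈ D} w x) :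
    ∃ w x : β → β → ℕ → ℕ → K, CubicIndep (blockPoint b D w x) := by
  let σ := β × β × Bool × ℕ × ℕ
  have hpoly (s : σ) : IsPolyFun fun θ : σ → K => θ s := IsPolyFun.coord s
  have h1 : ∀ᶠ θ : σ → K in generic σ K, ∀ i j k, i < j → j < k → TripleCond (b i) (b j) (b k)
      (fun l a => θ (i, j, false, l, a)) (fun l a => θ (i, j, true, l, a))
      (fun l a => θ (i, k, false, l, a)) (fun l a => θ (i, k, true, l, a))
      (fun l a => θ (j, k, false, l, a)) (fun l a => θ (j, k, true, l, a)) := by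
    refine Filter.eventually_all.mpr fun i => Filter.eventually_all.mpr fun j =>
      Filter.eventually_all.mpr fun k => ?_
    by_cases hij : i < j
    swap
    · simp [hij]
    by_cases hjk : j < k
    swap
    · simp [hjk]
    simp only [hij, hjk, true_imp_iff]
    obtain ⟨w, x, w', y, u, v, h⟩ := hT i j k hij hjk
    refine eventually_tripleCond (fun _ _ => hpoly _) (fun _ _ => hpoly _) (fun _ _ => hpoly _)
      (fun _ _ => hpoly _) (fun _ _ => hpoly _) (fun _ _ => hpoly _) (θ₀ := fun s =>
        if s.1 = j then (if s.2.2.1 then v s.2.2.2.1 s.2.2.2.2 else u s.2.2.2.1 s.2.2.2.2)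
        else if s.2.1 = j then
          (if s.2.2.1 then x s.2.2.2.1 s.2.2.2.2 else w s.2.2.2.1 s.2.2.2.2)
        else (if s.2.2.1 then y s.2.2.2.1 s.2.2.2.2 else w' s.2.2.2.1 s.2.2.2.2)) ?_
    simpa [hij.ne, hjk.ne'] using h
  have h2 : ∀ᶠ θ : σ → K in generic σ K, ∀ i j, i < j → PairCond (b i) (b j) {a | ⟨i, a⟩ ∈ D}
      (fun l a => θ (i, j, false, l, a)) (fun l a => θ (i, j, true, l, a)) := by
    refine Filter.eventually_all.mpr fun i => Filter.eventually_all.mpr fun j => ?_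
    by_cases hij : i < j
    swap
    · simp [hij]
    simp only [hij, true_imp_iff]
    obtain ⟨w, x, h⟩ := hP i j hij
    exact eventually_pairCond (fun _ _ => hpoly _) (fun _ _ => hpoly _) (θ₀ := fun s =>
        if s.2.2.1 then x s.2.2.2.1 s.2.2.2.2 else w s.2.2.2.1 s.2.2.2.2) (by simpa using h)
  obtain ⟨θ, hθ1, hθ2⟩ := (h1.and h2).exists
  exact ⟨fun i j l a => θ (i, j, false, l, a), fun i j l a => θ (i, j, true, l, a),
    cubicIndep_blockPoint D _ _ hθ1 hθ2⟩

end GenericBlocks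

section Witness

variable {K : Type*} [Field K]

/-- The matrix with the given rows, extended by zero. -/
def ofRows (L : List (List ℤ)) (i j : ℕ) : K := ((L.getD i []).getD j 0 : ℤ)

lemma tripleCond_two [CharZero K] : TripleCond (K := K) 2 3 3 (ofRows [[1, 0], [0, 1]])
    (ofRows [[1, -1, 0], [0, 1, 1]]) (ofRows [[1, 1], [1, 1]]) (ofRows [[1, -1, 0], [0, -1, 1]])
    (ofRows [[1, 0, 0], [0, 1, 0], [0, 0, 1]]) (ofRows [[1, 0, 0], [0, 1, 0], [0, 0, 1]]) := by
  intro f g h H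
  simp [Fin.forall_fin_succ, Fin.sum_univ_succ, ofRows] at H
  simp [funext_iff, Fin.forall_fin_succ]
  grind

lemma tripleCond_three [CharZero K] : TripleCond (K := K) 3 3 3
    (ofRows [[1, 0, 0], [0, 1, 0], [0, 0, 1]]) (ofRows [[-1, 0, 1], [0, -1, 1], [1, 1, 1]])
    (ofRows [[-1, 0, 1], [0, 1, 1], [1, -1, -1]]) (ofRows [[1, 0, 1], [-1, -1, -1], [1, 1, 0]])
    (ofRows [[1, 0, 0], [0, 1, 0], [0, 0, 1]]) (ofRows [[1, 0, 0], [0, 1, 0], [0, 0, 1]]) := by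
  intro f g h H
  simp [Fin.forall_fin_succ, Fin.sum_univ_succ, ofRows] at H
  simp [funext_iff, Fin.forall_fin_succ]
  grind

lemma tripleCond_four [CharZero K] : TripleCond (K := K) 4 3 3
    (ofRows [[1, 0, 0, 0], [0, 1, 0, 0], [0, 0, 1, 0], [0, 0, 0, 1]])
    (ofRows [[-1, 0, -1], [1, 0, -1], [0, 1, -1], [0, 1, 1]])
    (ofRows [[1, 0, 0, 1], [-1, 1, 0, 1], [1, -1, 1, -1], [1, 0, 1, 1]])
    (ofRows [[1, 0, -1], [-1, 1, 0], [1, 0, -1], [1, 1, 0]])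
    (ofRows [[1, 0, 0], [0, 1, 0], [0, 0, 1]]) (ofRows [[1, 0, 0], [0, 1, 0], [0, 0, 1]]) := by
  intro f g h H
  simp [Fin.forall_fin_succ, Fin.sum_univ_succ, ofRows] at H
  simp [funext_iff, Fin.forall_fin_succ]
  grind

lemma pairCond_two [CharZero K] {D : Set (Fin 2)} (hD : 1 ∈ D) : PairCond (K := K) 2 3 D
    (ofRows [[0, 1], [1, 1]]) (ofRows [[1, 0, 1], [0, 1, -1]]) := by
  intro f g H H'
  have H1 := fun b => H 1 1 b fun _ => hD
  have H2 := fun b => H 0 1 b fun h => absurd h (by decide)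
  simp [Fin.forall_fin_succ, Fin.sum_univ_succ, ofRows] at H1 H2 H'
  simp [funext_iff, Fin.forall_fin_succ]
  grind

lemma pairCond_three [CharZero K] {D : Set (Fin 3)} : PairCond (K := K) 3 3 D
    (ofRows [[-1, 0, 1], [1, -1, 1], [-1, 1, 0]])
    (ofRows [[0, 1, -1], [-1, -1, -1], [-1, 0, 1]]) := by
  intro f g H H'
  replace H := fun a a' b (h : a < a') => H a a' b fun h' => absurd h' h.ne
  replace H' := fun a b b' (h : b < b') => H' a b b' h.ne
  simp [Fin.forall_fin_succ, Fin.sum_univ_succ, ofRows] at H H'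
  simp [funext_iff, Fin.forall_fin_succ]
  grind

lemma pairCond_four [CharZero K] {D : Set (Fin 4)} : PairCond (K := K) 4 3 D
    (ofRows [[0, 1, 0, -1], [0, 0, 1, 1], [1, 1, -1, -1], [-1, 0, 1, 1]])
    (ofRows [[1, 0, 1], [1, 1, 0], [0, 1, 1], [1, 0, -1]]) := by
  intro f g H H'
  replace H := fun a a' b (h : a < a') => H a a' b fun h' => absurd h' h.ne
  replace H' := fun a b b' (h : b < b') => H' a b b' h.ne
  simp [Fin.forall_fin_succ, Fin.sum_univ_succ, ofRows] at H H'
  simp [funext_iff, Fin.forall_fin_succ]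
  grind (splits := 40)

end Witness

section Cubic

variable {K : Type*} [Field K] [CharZero K]

variable (K) in
lemma exists_tripleCond {p q r : ℕ} (h2 : 2 ≤ p) (h4 : p ≤ 4) (hq : q = 3) (hr : r = 3) :
    ∃ w x w' y u v : ℕ → ℕ → K, TripleCond p q r w x w' y u v := by
  subst hq hr
  interval_cases p
  exacts [⟨_, _, _, _, _, _, tripleCond_two⟩, ⟨_, _, _, _, _, _, tripleCond_three⟩,
    ⟨_, _, _, _, _, _, tripleCond_four⟩]

variable (K) in
lemma exists_pairCond {p q : ℕ} (h2 : 2 ≤ p) (h4 : p ≤ 4) (hq : q = 3) {D : Set (Fin p)}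
    (hD : p = 2 → ∀ a : Fin p, (a : ℕ) = 1 → a ∈ D) : ∃ w x : ℕ → ℕ → K, PairCond p q D w x := by
  subst hq
  interval_cases p
  exacts [⟨_, _, pairCond_two (hD rfl 1 rfl)⟩, ⟨_, _, pairCond_three⟩, ⟨_, _, pairCond_four⟩]

lemma sum_blockSize_lt (c k : ℕ) :
    2 * ∑ e : {e : Fin (k + 1) × Fin (k + 1) // e.1 < e.2}, (if e.1.1 = 0 then c else 3) + 3 * k =
      2 * c * k + 3 * k ^ 2 := by
  have h1 : ∑ e : {e : Fin (k + 1) × Fin (k + 1) // e.1 < e.2}, (if e.1.1 = 0 then c else 3) =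
      ∑ i : Fin (k + 1), (if i = 0 then c else 3) * (k - i) := by
    rw [← Finset.sum_subtype (Finset.univ.filter fun e : Fin (k + 1) × Fin (k + 1) => e.1 < e.2)
      (by simp) (fun e => if e.1 = 0 then c else 3), Finset.sum_filter, Fintype.sum_prod_type]
    refine Finset.sum_congr rfl fun i _ => ?_
    rw [← Finset.sum_filter]
    have : (Finset.univ.filter fun j => i < j).card = k - i := by
      simp [Finset.filter_lt_eq_Ioi]
    rw [Finset.sum_congr rfl (g := fun _ => if i = 0 then c else 3) fun _ _ => by congr,
      Finset.sum_const, this, smul_eq_mul, mul_comm]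
  have h2 : ∀ k : ℕ, 2 * ∑ i : Fin k, (k - (i + 1)) + k = k ^ 2 := by
    intro k
    rw [Fin.sum_univ_eq_sum_range (fun i => k - (i + 1)) k, ← Finset.sum_range_reflect]
    have : ∑ j ∈ Finset.range k, (k - (k - 1 - j + 1)) = ∑ j ∈ Finset.range k, j :=
      Finset.sum_congr rfl fun j hj => by have := Finset.mem_range.mp hj; omega
    rw [this, mul_comm, Finset.sum_range_id_mul_two]
    cases k <;> simp; ring
  rw [h1, Fin.sum_univ_succ]
  simp only [if_true, Fin.val_zero, Nat.sub_zero, Fin.succ_ne_zero, if_false, Fin.val_succ,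
    ← Finset.mul_sum]
  have := h2 k
  nlinarith

lemma choose_three_le {c k t s : ℕ} (hc2 : 2 ≤ c) (hc4 : c ≤ 4)
    (ht : (c = 2 ∧ 1 ≤ k ∧ c + 3 * k ≤ t + 1) ∨ c + 3 * k ≤ t)
    (hs : 2 * s + 3 * k = 2 * c * k + 3 * k ^ 2) :
    (c + 3 * k + 3 - 1).choose 3 ≤ (t + s) * (c + 3 * k + 1) := by
  have hchoose : 6 * (c + 3 * k + 3 - 1).choose 3 =
      (c + 3 * k + 2) * (c + 3 * k + 1) * (c + 3 * k) := by
    generalize c + 3 * k = M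
    have := Nat.descFactorial_eq_factorial_mul_choose (M + 2) 3
    simp only [Nat.descFactorial, Nat.factorial] at this
    rw [show M + 2 - 2 = M by omega, show M + 2 - 1 = M + 1 by omega,
      show M + 2 - 0 = M + 2 by omega] at this
    rw [show M + 3 - 1 = M + 2 by omega]
    linarith
  have h6 : (c + 3 * k + 2) * (c + 3 * k) ≤ 6 * (t + s) := by
    rcases ht with ⟨rfl, hk, ht⟩ | ht
    · nlinarith
    · have hck : c ^ 2 ≤ 4 * c + 3 * k := by nlinarith
      nlinarith
  nlinarith

/-- The sizes of the blocks. -/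
def blockSize (c k : ℕ) (i : Fin (k + 1)) : ℕ := if i = 0 then c else 3

/-- The coordinate points that are left out. -/
def blockDrop (c k : ℕ) : Set (Σ i, Fin (blockSize c k i)) :=
  {s | s.1 = 0 ∧ (s.2 : ℕ) = 1 ∧ c = 2 ∧ 1 ≤ k}

lemma card_sigma_blockSize (c k : ℕ) : Fintype.card (Σ i, Fin (blockSize c k i)) = c + 3 * k := by
  rw [Fintype.card_sigma, Fin.sum_univ_succ]
  simp [blockSize, mul_comm]

lemma card_blockPoints_le {c k : ℕ} (hc2 : 2 ≤ c) (hc4 : c ≤ 4) : (c + 3 * k + 3 - 1).choose 3 ≤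
    Nat.card (BlockPoints (blockSize c k) (blockDrop c k)) * (c + 3 * k + 1) := by
  have hD : Nat.card {s // s ∈ blockDrop c k} + Nat.card {s // s ∉ blockDrop c k} =
      c + 3 * k := by
    classical
    rw [← Nat.card_sum, ← card_sigma_blockSize, ← Nat.card_eq_fintype_card]
    exact Nat.card_congr (Equiv.sumCompl (· ∈ blockDrop c k))
  have hD1 : Nat.card {s // s ∈ blockDrop c k} ≤ 1 := by
    rw [Finite.card_le_one_iff_subsingleton]
    refine ⟨?_⟩
    rintro ⟨⟨i, a⟩, h1, h2, -⟩ ⟨⟨j, a'⟩, h1', h2', -⟩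
    simp only at h1 h2 h1' h2'
    subst h1 h1'
    have : a = a' := Fin.ext (h2.trans h2'.symm)
    subst this
    rfl
  have hD0 (h : ¬ (c = 2 ∧ 1 ≤ k)) : Nat.card {s // s ∈ blockDrop c k} = 0 := by
    have : IsEmpty {s // s ∈ blockDrop c k} := ⟨fun s => h s.2.2.2⟩
    exact Nat.card_of_isEmpty
  have hs : Nat.card (Σ e : {e : Fin (k + 1) × Fin (k + 1) // e.1 < e.2},
      Fin (blockSize c k e.1.1)) = ∑ e : {e : Fin (k + 1) × Fin (k + 1) // e.1 < e.2},
        (if e.1.1 = 0 then c else 3) := by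
    rw [Nat.card_sigma]
    simp [blockSize]
  rw [BlockPoints, Nat.card_sum, hs]
  refine choose_three_le hc2 hc4 ?_ (sum_blockSize_lt c k)
  by_cases h : c = 2 ∧ 1 ≤ k
  · exact .inl ⟨h.1, h.2, by omega⟩
  · exact .inr (by have := hD0 h; omega)

variable (K) in
lemma exists_cubicIndep {c k : ℕ} (hc2 : 2 ≤ c) (hc4 : c ≤ 4)
    [DecidablePred (· ∈ blockDrop c k)] :
    ∃ w x : Fin (k + 1) → Fin (k + 1) → ℕ → ℕ → K,
      CubicIndep (blockPoint (blockSize c k) (blockDrop c k) w x) := by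
  have hb {i : Fin (k + 1)} (hi : i ≠ 0) : blockSize c k i = 3 := if_neg hi
  have hb2 (i) : 2 ≤ blockSize c k i := by by_cases hi : i = 0 <;> simp [blockSize, hi, hc2]
  have hb4 (i) : blockSize c k i ≤ 4 := by by_cases hi : i = 0 <;> simp [blockSize, hi, hc4]
  have hlt {i j : Fin (k + 1)} (h : i < j) : j ≠ 0 := ((Fin.zero_le i).trans_lt h).ne'
  refine exists_cubicIndep_blockPoint (K := K) _
    (fun i j k hij hjk => exists_tripleCond K (hb2 i) (hb4 i) (hb (hlt hij)) (hb (hlt hjk)))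
    (fun i j hij => exists_pairCond K (hb2 i) (hb4 i) (hb (hlt hij)) fun h a ha => ?_)
  have hi : i = 0 := by
    by_contra hi
    rw [hb hi] at h
    omega
  refine ⟨hi, ha, by subst hi; exact h, ?_⟩
  have h1 := j.2
  have h2 : (i : ℕ) < j := hij
  omega

/-- The maximal rank property of double points for cubics, up to one point. -/
lemma exists_linearIndependent_gradAt_three {ι : Type*} [Fintype ι] [DecidableEq ι]
    (hι : 2 ≤ Fintype.card ι) : ∃ (T : ℕ) (x : Fin T → ι → K),
      LinearIndependent K (fun a : Fin T × ι => gradAt 3 (x a.1) a.2) ∧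
      Module.finrank K (Forms ι K 3) ≤ T * (Fintype.card ι + 1) := by
  classical
  obtain ⟨k, c, hM, hc2, hc4⟩ : ∃ k c, Fintype.card ι = c + 3 * k ∧ 2 ≤ c ∧ c ≤ 4 :=
    ⟨(Fintype.card ι - 2) / 3, (Fintype.card ι - 2) % 3 + 2, by omega, by omega, by omega⟩
  obtain ⟨w, x, hq⟩ := exists_cubicIndep K (k := k) hc2 hc4
  let e : ι ≃ Σ i, Fin (blockSize c k i) :=
    Fintype.equivOfCardEq (hM.trans (card_sigma_blockSize c k).symm)
  obtain ⟨T, y, hy, hT⟩ : ∃ (T : ℕ) (y : Fin T → ι → K), CubicIndep y ∧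
      T = Nat.card (BlockPoints (blockSize c k) (blockDrop c k)) :=
    ⟨_, _, (hq.comp_equiv e).reindex (Fintype.equivFin _).symm, Nat.card_eq_fintype_card.symm⟩
  refine ⟨T, y, hy.linearIndependent, ?_⟩
  rw [finrank_forms, hM, hT]
  exact card_blockPoints_le hc2 hc4

/-- The maximal rank property of double points, up to one point. -/
lemma exists_linearIndependent_gradAt {ι : Type*} [Fintype ι] [DecidableEq ι]
    {d : ℕ} (hd : 3 ≤ d) (hι : 2 ≤ Fintype.card ι) : ∃ (T : ℕ) (x : Fin T → ι → K),
      LinearIndependent K (fun a : Fin T × ι => gradAt d (x a.1) a.2) ∧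
      Module.finrank K (Forms ι K d) ≤ T * (Fintype.card ι + 1) := by
  rcases hd.eq_or_lt with rfl | hd
  · exact exists_linearIndependent_gradAt_three hι
  · exact exists_linearIndependent_gradAt_of_four_le hd hι

end Cubic

section SimplePoints

variable {K : Type*} [Field K] [CharZero K] {ι κ : Type*} [Fintype ι] [Finite κ]

omit [Finite κ] in
lemma exists_finrank_inf_commonKer_evalAt_le {d : ℕ} (B : Type*) [Finite B] :
    ∀ V : Submodule K (Forms ι K d), ∃ y : B → ι → K,
      Module.finrank K ↥(V ⊓ commonKer fun b => evalAt d (y b)) ≤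
        Module.finrank K V - Nat.card B := by
  induction B using Finite.induction_empty_option with
  | of_equiv e h =>
    intro V
    obtain ⟨y, hy⟩ := h V
    refine ⟨y ∘ e.symm, ?_⟩
    have : (commonKer fun b => evalAt d ((y ∘ e.symm) b)) = commonKer fun b => evalAt d (y b) := by
      ext F
      simp only [mem_commonKer, Function.comp_apply]
      exact ⟨fun h a => by simpa using h (e a), fun h a => h _⟩
    rwa [this, ← Nat.card_congr e]
  | h_empty =>
    intro V
    refine ⟨fun b => b.elim, ?_⟩
    simpa using Submodule.finrank_mono inf_le_left
  | h_option h =>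
    intro V
    by_cases hV : V = ⊥
    · subst hV
      refine ⟨fun _ => 0, ?_⟩
      simp
    obtain ⟨F, hF, hF0⟩ := V.exists_mem_ne_zero_of_ne_bot hV
    obtain ⟨y₀, hy₀⟩ : ∃ y, evalAt d y F ≠ 0 := by
      by_contra! hc
      refine hF0 (Subtype.ext (MvPolynomial.funext fun y => ?_))
      simpa [evalAt_apply] using hc y
    obtain ⟨y, hy⟩ := h (V ⊓ LinearMap.ker (evalAt d y₀))
    refine ⟨fun o => o.elim y₀ y, ?_⟩
    have h1 : (V ⊓ commonKer fun b : Option _ => evalAt d (b.elim y₀ y)) =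
        V ⊓ LinearMap.ker (evalAt d y₀) ⊓ commonKer fun b => evalAt d (y b) := by
      ext G
      simp [mem_commonKer, Option.forall, and_assoc]
    have h2 : Module.finrank K ↥(V ⊓ LinearMap.ker (evalAt d y₀)) < Module.finrank K V :=
      Submodule.finrank_lt_finrank_of_lt (lt_of_le_of_ne inf_le_left fun he =>
        hy₀ (by rw [← he] at hF; exact hF.2))
    rw [h1, Finite.card_option]
    omega

/-- The conditions to be singular at the points of one group, and to vanish at the points of the
other groups. -/
def groupCond (d : ℕ) {t : ℕ} (k : κ) (q : κ → Fin t → ι → K) :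
    (Fin t × ι) ⊕ ({k' // k' ≠ k} × Fin t) → Module.Dual K (Forms ι K d) :=
  Sum.elim (fun a => gradAt d (q k a.1) a.2) (fun a => evalAt d (q a.1 a.2))

omit [CharZero K] in
lemma finrank_forms_add_le {d T : ℕ} {x : Fin T → ι → K}
    (hx : LinearIndependent K (fun a : Fin T × ι => gradAt d (x a.1) a.2)) (t : ℕ) :
    Module.finrank K (commonKer fun a : Fin t × ι =>
      gradAt d (if h : (a.1 : ℕ) < T then x ⟨a.1, h⟩ else 0) a.2) + min t T * Fintype.card ι ≤
      Module.finrank K (Forms ι K d) := by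
  have hx' : LinearIndependent K (fun a : Fin (min t T) × ι =>
      gradAt d (x (a.1.castLE (min_le_right _ _))) a.2) :=
    hx.comp (fun a : Fin (min t T) × ι => (a.1.castLE (min_le_right _ _), a.2)) fun a b h => by
      simpa [Prod.ext_iff] using h
  rw [← finrank_span_add_finrank_commonKer (fun a : Fin (min t T) × ι =>
      gradAt d (x (a.1.castLE (min_le_right _ _))) a.2), finrank_span_eq_card hx',
    Fintype.card_prod, Fintype.card_fin, add_comm]
  gcongr
  refine Submodule.finrank_mono fun F hF => ?_
  rw [mem_commonKer] at hF ⊢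
  rintro ⟨j, i⟩
  have := hF (j.castLE (min_le_left _ _), i)
  have hj : (j : ℕ) < T := j.2.trans_le (min_le_right _ _)
  simpa only [Fin.val_castLE, hj, dif_pos] using! this

lemma exists_finrank_groupCond_le {d : ℕ} (hd : 3 ≤ d) (hι : 2 ≤ Fintype.card ι) (t : ℕ) (k : κ)
    (hκ : 2 ≤ Nat.card κ) : ∃ q : κ → Fin t → ι → K,
      Module.finrank K (commonKer (groupCond d k q)) ≤
        Module.finrank K (Forms ι K d) - t * (Fintype.card ι + (Nat.card κ - 1)) := by
  classical
  obtain ⟨T, x, hx, hT⟩ := exists_linearIndependent_gradAt (K := K) hd hι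
  have h1 := finrank_forms_add_le hx t
  set x' : Fin t → ι → K := fun j => if h : (j : ℕ) < T then x ⟨j, h⟩ else 0 with hx'
  obtain ⟨y, hy⟩ := exists_finrank_inf_commonKer_evalAt_le ({k' // k' ≠ k} × Fin t)
    (commonKer fun a : Fin t × ι => gradAt d (x' a.1) a.2)
  refine ⟨fun k' j => if h : k' = k then x' j else y (⟨k', h⟩, j), ?_⟩
  have h2 : commonKer (groupCond d k fun k' j => if h : k' = k then x' j else y (⟨k', h⟩, j)) =
      (commonKer fun a : Fin t × ι => gradAt d (x' a.1) a.2) ⊓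
        commonKer fun b => evalAt d (y b) := by
    ext F
    simp only [mem_commonKer, groupCond, Sum.forall, Submodule.mem_inf, Sum.elim_inl, Sum.elim_inr,
      dif_pos]
    refine and_congr_right' (forall_congr' fun a => ?_)
    rw [dif_neg a.1.2]
  have h3 : Nat.card ({k' // k' ≠ k} × Fin t) = (Nat.card κ - 1) * t := by
    have := Fintype.ofFinite κ
    rw [Nat.card_prod, Nat.card_fin, Nat.card_eq_fintype_card, Nat.card_eq_fintype_card]
    simp
  rw [h2]
  rw [h3] at hy
  refine hy.trans ?_
  obtain ⟨c, hc⟩ : ∃ c, Nat.card κ - 1 = c + 1 := ⟨Nat.card κ - 2, by omega⟩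
  rw [hc]
  rcases le_total t T with htT | htT
  · rw [min_eq_left htT] at h1
    rw [mul_add]
    rw [mul_comm (c + 1) t]
    change Module.finrank K (commonKer fun a : Fin t × ι => gradAt d (x' a.1) a.2) + _ ≤ _ at h1
    omega
  · rw [min_eq_right htT] at h1
    change Module.finrank K (commonKer fun a : Fin t × ι => gradAt d (x' a.1) a.2) + _ ≤ _ at h1
    have : Module.finrank K (commonKer fun a : Fin t × ι => gradAt d (x' a.1) a.2) ≤
        (c + 1) * t := by nlinarith
    omega

/-- General groups of points have the expected numbers of conditions for all groups at once. -/
lemma exists_forall_finrank_groupCond_le {d : ℕ} (hd : 3 ≤ d) (hι : 2 ≤ Fintype.card ι) (t : ℕ)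
    (hκ : 2 ≤ Nat.card κ) (i₀ : ι) : ∃ q : κ → Fin t → ι → K, (∀ k j, q k j i₀ ≠ 0) ∧
      ∀ k, Module.finrank K (commonKer (groupCond d k q)) ≤
        Module.finrank K (Forms ι K d) - t * (Fintype.card ι + (Nat.card κ - 1)) := by
  have h1 : ∀ᶠ z in generic (κ × Fin t × ι) K, ∀ k j, z (k, j, i₀) ≠ 0 := by
    simp only [Filter.eventually_all]
    exact fun k j => (IsPolyFun.coord _).eventually_ne_zero (x₀ := fun _ => 1) one_ne_zero
  have h2 : ∀ᶠ z in generic (κ × Fin t × ι) K, ∀ k,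
      Module.finrank K (commonKer (groupCond d k fun k j i => z (k, j, i))) ≤
        Module.finrank K (Forms ι K d) - t * (Fintype.card ι + (Nat.card κ - 1)) := by
    rw [Filter.eventually_all]
    intro k
    obtain ⟨q, hq⟩ := exists_finrank_groupCond_le (K := K) hd hι t k hκ
    refine eventually_finrank_commonKer_le
      (L := fun a z => groupCond d k (fun k j i => z (k, j, i)) a) ?_
      (x₀ := fun a => q a.1 a.2.1 a.2.2) hq
    rintro (a | a) F
    · exact isPolyFun_gradAt d (fun i => .coord _) _ F
    · exact isPolyFun_evalAt d (fun i => .coord _) F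
  obtain ⟨z, hz1, hz2⟩ := (h1.and h2).exists
  exact ⟨_, hz1, hz2⟩

end SimplePoints

section Special

variable {K : Type*} [Field K] {n m d : ℕ}

/-- The indices of the variables `z₀, …, zₙ₋₁, x₀`. -/
def specialVar (n m : ℕ) : Fin (n + 1) → Fin (n + (m + 1)) :=
  Fin.lastCases (Fin.natAdd n (Fin.last m)) (Fin.castAdd (m + 1))

@[simp]
lemma specialVar_last : specialVar n m (Fin.last n) = Fin.natAdd n (Fin.last m) := by
  simp [specialVar]

@[simp]
lemma specialVar_castSucc (i : Fin n) : specialVar n m i.castSucc = Fin.castAdd (m + 1) i := by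
  simp [specialVar]

variable (K n m d) in
/-- The map sending `(F₀, …, Fₙ)` to `z₀ F₀ + ⋯ + zₙ₋₁ Fₙ₋₁ + x₀ Fₙ`. -/
def assemble : (Fin (n + 1) → Forms (Fin (m + 1)) K d) →ₗ[K]
    Forms (Fin (n + (m + 1))) K (d + 1) :=
  (∑ k, LinearMap.mulLeft K (X (specialVar n m k)) ∘ₗ (rename (Fin.natAdd n)).toLinearMap ∘ₗ
    (Forms (Fin (m + 1)) K d).subtype ∘ₗ LinearMap.proj k).codRestrict _ fun F => by
      simp only [LinearMap.sum_apply]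
      refine Submodule.sum_mem _ fun k _ => ?_
      rw [mem_homogeneousSubmodule, add_comm d 1]
      exact (isHomogeneous_X K _).mul (IsHomogeneous.rename_isHomogeneous (F k).2)

lemma coe_assemble (F : Fin (n + 1) → Forms (Fin (m + 1)) K d) :
    (assemble K n m d F : MvPolynomial _ K) =
      ∑ k, X (specialVar n m k) * rename (Fin.natAdd n) (F k).1 := by
  simp [assemble]

lemma pderiv_castAdd_rename (i : Fin n) (F : MvPolynomial (Fin (m + 1)) K) :
    pderiv (Fin.castAdd (m + 1) i) (rename (Fin.natAdd n) F) = 0 := by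
  refine pderiv_eq_zero_of_notMem_vars fun h => ?_
  classical
  obtain ⟨j, -, hj⟩ := Finset.mem_image.mp (vars_rename _ _ h)
  simp [Fin.ext_iff] at hj
  omega

lemma pderiv_natAdd_rename (j : Fin (m + 1)) (F : MvPolynomial (Fin (m + 1)) K) :
    pderiv (Fin.natAdd n j) (rename (Fin.natAdd n) F) = rename (Fin.natAdd n) (pderiv j F) :=
  pderiv_rename (Fin.natAdd_injective _ _) j F

lemma pderiv_castAdd_assemble (i : Fin n) (F : Fin (n + 1) → Forms (Fin (m + 1)) K d) :
    pderiv (Fin.castAdd (m + 1) i) (assemble K n m d F).1 =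
      rename (Fin.natAdd n) (F i.castSucc).1 := by
  have h (i : Fin n) : Fin.natAdd n (Fin.last m) ≠ Fin.castAdd (m + 1) i := by
    simp [Fin.ext_iff]; omega
  simp [-Fin.natAdd_last, coe_assemble, Fin.sum_univ_castSucc, pderiv_castAdd_rename, pderiv_X,
    Pi.single_apply, h,
    eq_comm, Derivation.leibniz]

lemma gradAt_castAdd_assemble (z : Fin n → K) (q : Fin (m + 1) → K) (i : Fin n)
    (F : Fin (n + 1) → Forms (Fin (m + 1)) K d) :
    gradAt (d + 1) (Fin.append z q) (Fin.castAdd (m + 1) i) (assemble K n m d F) =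
      evalAt d q (F i.castSucc) := by
  rw [gradAt_apply, pderiv_castAdd_assemble, eval_rename, evalAt_apply]
  congr 2
  ext j
  simp

lemma pderiv_natAdd_assemble (j : Fin (m + 1)) (F : Fin (n + 1) → Forms (Fin (m + 1)) K d) :
    pderiv (Fin.natAdd n j) (assemble K n m d F).1 =
      ∑ i : Fin n, X (Fin.castAdd (m + 1) i) * rename (Fin.natAdd n) (pderiv j (F i.castSucc).1) +
        (X (Fin.natAdd n (Fin.last m)) * rename (Fin.natAdd n) (pderiv j (F (Fin.last n)).1) +
          if j = Fin.last m then rename (Fin.natAdd n) (F (Fin.last n)).1 else 0) := by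
  have h (i : Fin n) : pderiv (Fin.natAdd n j) (X (Fin.castAdd (m + 1) i) : MvPolynomial _ K) = 0 :=
    pderiv_X_of_ne (by simp [Fin.ext_iff]; omega)
  rw [coe_assemble, Fin.sum_univ_castSucc, map_add, map_sum]
  congr 1
  · refine Finset.sum_congr rfl fun i _ => ?_
    rw [pderiv_mul, specialVar_castSucc, h, zero_mul, zero_add, pderiv_natAdd_rename]
  · rw [pderiv_mul, specialVar_last, pderiv_natAdd_rename, add_comm (_ * rename _ _)]
    congr 1
    split_ifs with hj
    · rw [hj, pderiv_X_self, one_mul]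
    · rw [pderiv_X_of_ne, zero_mul]
      exact fun hc => hj (Fin.natAdd_injective _ _ hc).symm

lemma gradAt_natAdd_assemble (z : Fin n → K) (q : Fin (m + 1) → K) (j : Fin (m + 1))
    (F : Fin (n + 1) → Forms (Fin (m + 1)) K d) :
    gradAt (d + 1) (Fin.append z q) (Fin.natAdd n j) (assemble K n m d F) =
      ∑ i : Fin n, z i * gradAt d q j (F i.castSucc) +
        (q (Fin.last m) * gradAt d q j (F (Fin.last n)) +
          if j = Fin.last m then evalAt d q (F (Fin.last n)) else 0) := by
  have h : Fin.append z q ∘ Fin.natAdd n = q := by ext; simp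
  simp only [gradAt_apply, evalAt_apply, pderiv_natAdd_assemble, map_add, map_sum, map_mul, eval_X,
    eval_rename, h, Fin.append_left, Fin.append_right]
  congr 2
  split_ifs
  · rw [eval_rename, h]
  · simp

lemma evalAt_assemble (z : Fin n → K) (q : Fin (m + 1) → K)
    (F : Fin (n + 1) → Forms (Fin (m + 1)) K d) :
    evalAt (d + 1) (Fin.append z q) (assemble K n m d F) =
      ∑ i : Fin n, z i * evalAt d q (F i.castSucc) +
        q (Fin.last m) * evalAt d q (F (Fin.last n)) := by
  have h' : Fin.append z q ∘ Fin.natAdd n = q := by ext; simp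
  simp [evalAt_apply, coe_assemble, Fin.sum_univ_castSucc, eval_rename, h', -Fin.natAdd_last]

lemma assemble_injective : Function.Injective (assemble K n m d) := by
  rw [← LinearMap.ker_eq_bot, LinearMap.ker_eq_bot']
  intro F hF
  have h1 (i : Fin n) : F i.castSucc = 0 := by
    have := pderiv_castAdd_assemble i F
    rw [hF] at this
    refine Subtype.ext (rename_injective _ (Fin.natAdd_injective (m + 1) n) ?_)
    simpa using this.symm
  ext1 k
  refine Fin.lastCases ?_ h1 k
  have := coe_assemble F
  simp only [hF, Fin.sum_univ_castSucc, h1] at this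
  refine Subtype.ext (rename_injective _ (Fin.natAdd_injective (m + 1) n) ?_)
  simpa using this.symm

/-- The conditions on `(F₀, …, Fₙ)` for the assembled form to be singular at given points. -/
def singCond (d : ℕ) {B : Type*} (p : B → Fin (n + (m + 1)) → K) (a : B × Fin (n + (m + 1))) :
    Module.Dual K (Fin (n + 1) → Forms (Fin (m + 1)) K d) :=
  gradAt (d + 1) (p a.1) a.2 ∘ₗ assemble K n m d

lemma mem_commonKer_singCond {B : Type*} {p : B → Fin (n + (m + 1)) → K}
    {F : Fin (n + 1) → Forms (Fin (m + 1)) K d} :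
    F ∈ commonKer (singCond d p) ↔
      ∀ b j, gradAt (d + 1) (p b) j (assemble K n m d F) = 0 := by
  simp [mem_commonKer, singCond]

/-- A point over `q` in the fibre that belongs to the group `k`. -/
def fibrePoint (k : Fin (n + 1)) (q : Fin (m + 1) → K) : Fin (n + (m + 1)) → K :=
  Fin.append (fun i => if k = i.castSucc then q (Fin.last m) else 0) q

variable (K n m d) in
/-- The map `(F₀, …, Fₙ) ↦ (F₀ + Fₙ, …, Fₙ₋₁ + Fₙ, Fₙ)`. -/
def shear (k : Fin (n + 1)) : (Fin (n + 1) → Forms (Fin (m + 1)) K d) →ₗ[K]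
    Forms (Fin (m + 1)) K d where
  toFun F := if k = Fin.last n then F (Fin.last n) else F k + F (Fin.last n)
  map_add' F G := by
    simp only [Pi.add_apply]
    split_ifs
    · rfl
    · abel
  map_smul' c F := by
    simp only [Pi.smul_apply, RingHom.id_apply, ← smul_add]
    split_ifs <;> rfl

lemma shear_apply (k : Fin (n + 1)) (F : Fin (n + 1) → Forms (Fin (m + 1)) K d) :
    shear K n m d k F = if k = Fin.last n then F (Fin.last n) else F k + F (Fin.last n) := rfl

variable [CharZero K]

lemma shear_of_singular {k : Fin (n + 1)} {q : Fin (m + 1) → K} (hq : q (Fin.last m) ≠ 0)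
    {F : Fin (n + 1) → Forms (Fin (m + 1)) K d}
    (h : ∀ j, gradAt (d + 1) (fibrePoint k q) j (assemble K n m d F) = 0) :
    (∀ j, gradAt d q j (shear K n m d k F) = 0) ∧ ∀ k', evalAt d q (shear K n m d k' F) = 0 := by
  have h1 (i : Fin n) : evalAt d q (F i.castSucc) = 0 := by
    rw [← gradAt_castAdd_assemble]
    exact h _
  have h2 : evalAt d q (F (Fin.last n)) = 0 := by
    have := evalAt_eq_zero (Nat.succ_ne_zero d) h
    rw [fibrePoint, evalAt_assemble] at this
    simpa [h1, hq] using this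
  constructor
  · intro j
    have := h (Fin.natAdd n j)
    rw [fibrePoint, gradAt_natAdd_assemble] at this
    simp only [h2, ite_self, add_zero] at this
    revert this
    refine Fin.lastCases ?_ (fun i => ?_) k
    · have hl (i : Fin n) : Fin.last n ≠ i.castSucc := (Fin.castSucc_ne_last i).symm
      simp [hl, hq, shear_apply]
    · simp only [Fin.castSucc_inj, ite_mul, zero_mul, Finset.sum_ite_eq, Finset.mem_univ, if_true,
        shear_apply, Fin.castSucc_ne_last, if_false, ← mul_add]
      simp [hq]
  · intro k'
    refine Fin.lastCases ?_ (fun i => ?_) k'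
    · simp [shear_apply, h2]
    · simp [shear_apply, h2, h1, Fin.castSucc_ne_last]

lemma finrank_commonKer_singCond_le {t : ℕ} {q : Fin (n + 1) → Fin t → Fin (m + 1) → K}
    (hq : ∀ k j, q k j (Fin.last m) ≠ 0) {r : ℕ}
    (h : ∀ k, Module.finrank K (commonKer (groupCond d k q)) ≤ r) :
    Module.finrank K (commonKer (singCond d fun b : Fin (n + 1) × Fin t =>
      fibrePoint b.1 (q b.1 b.2))) ≤ (n + 1) * r := by
  set V := commonKer (singCond d fun b : Fin (n + 1) × Fin t => fibrePoint b.1 (q b.1 b.2))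
  have hV (F : V) (k) : shear K n m d k F.1 ∈ commonKer (groupCond d k q) := by
    have := mem_commonKer_singCond.mp F.2
    rw [mem_commonKer]
    rintro (⟨j, i⟩ | ⟨k', j⟩)
    · exact (shear_of_singular (hq _ _) (this (k, j))).1 i
    · exact (shear_of_singular (hq _ _) (this (k', j))).2 k
  let f : V →ₗ[K] ∀ k, commonKer (groupCond d k q) :=
    LinearMap.pi fun k => (shear K n m d k ∘ₗ V.subtype).codRestrict _ fun F => hV F k
  have hf : Function.Injective f := by
    intro F G hFG
    have h1 (k) : shear K n m d k F.1 = shear K n m d k G.1 :=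
      congrArg Subtype.val (congrFun hFG k)
    have h2 : F.1 (Fin.last n) = G.1 (Fin.last n) := by simpa [shear_apply] using h1 (Fin.last n)
    ext1
    ext1 k
    by_cases hk : k = Fin.last n
    · rw [hk]; exact h2
    · simpa [shear_apply, hk, h2] using h1 k
  refine (LinearMap.finrank_le_finrank_of_injective hf).trans ?_
  rw [Module.finrank_pi_fintype]
  refine (Finset.sum_le_card_nsmul _ _ r fun k _ => h k).trans ?_
  simp

variable (K) in
lemma exists_finrank_commonKer_singCond_le (hd : 3 ≤ d) (hn : 1 ≤ n) (hm : 1 ≤ m) (t : ℕ) :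
    ∃ p : Fin (n + 1) × Fin t → Fin (n + (m + 1)) → K,
      Module.finrank K (commonKer (singCond d p)) ≤
        (n + 1) * ((m + d).choose d - t * (m + n + 1)) := by
  obtain ⟨q, hq1, hq2⟩ := exists_forall_finrank_groupCond_le (K := K) (κ := Fin (n + 1))
    (ι := Fin (m + 1)) hd (by simp; omega) t (by simp; omega) (Fin.last m)
  refine ⟨_, (finrank_commonKer_singCond_le hq1 hq2).trans_eq ?_⟩
  rw [finrank_forms]
  simp only [Fintype.card_fin, Nat.card_fin, Nat.add_sub_cancel]
  rw [show m + 1 + d - 1 = m + d by omega, show m + 1 + n = m + n + 1 by omega]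

omit [CharZero K] in
variable (K n m d) in
lemma finrank_pi_forms : Module.finrank K (Fin (n + 1) → Forms (Fin (m + 1)) K d) =
    (n + 1) * (m + d).choose d := by
  rw [Module.finrank_pi_fintype]
  simp only [finrank_forms, Fintype.card_fin, Finset.sum_const, Finset.card_univ, smul_eq_mul]
  rw [show m + 1 + d - 1 = m + d by omega]

variable (K) in
lemma exists_linearIndependent_singCond (hd : 3 ≤ d) (hn : 1 ≤ n) (hm : 1 ≤ m) {s t : ℕ}
    (ht : t * (m + n + 1) ≤ (m + d).choose d) (hs : s ≤ (n + 1) * t) :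
    ∃ p : Fin s → Fin (n + (m + 1)) → K, LinearIndependent K (singCond d p) := by
  obtain ⟨p, hp⟩ := exists_finrank_commonKer_singCond_le K hd hn hm t
  have h1 := finrank_span_add_finrank_commonKer (singCond d p)
  rw [finrank_pi_forms] at h1
  have h2 : LinearIndependent K (singCond d p) := by
    rw [linearIndependent_iff_card_le_finrank_span]
    simp only [Fintype.card_prod, Fintype.card_fin, Set.finrank]
    obtain ⟨c, hc⟩ := Nat.exists_eq_add_of_le ht
    rw [hc, Nat.add_sub_cancel_left] at hp
    rw [hc] at h1
    nlinarith
  let e : Fin s ↪ Fin (n + 1) × Fin t := (Fin.castLEEmb hs).trans finProdFinEquiv.symm.toEmbedding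
  exact ⟨p ∘ e, h2.comp (fun a : Fin s × Fin (n + (m + 1)) => (e a.1, a.2))
    (e.injective.prodMap Function.injective_id)⟩

variable (K) in
lemma exists_finrank_commonKer_singCond_eq_zero (hd : 3 ≤ d) (hn : 1 ≤ n) (hm : 1 ≤ m) {s t : ℕ}
    (ht : (m + d).choose d ≤ t * (m + n + 1)) (hs : (n + 1) * t ≤ s) :
    ∃ p : Fin s → Fin (n + (m + 1)) → K, Module.finrank K (commonKer (singCond d p)) ≤ 0 := by
  obtain ⟨p, hp⟩ := exists_finrank_commonKer_singCond_le K hd hn hm t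
  rw [Nat.sub_eq_zero_of_le ht, mul_zero] at hp
  refine ⟨fun j => if h : (j : ℕ) < (n + 1) * t then p (finProdFinEquiv.symm ⟨j, h⟩) else 0,
    (Submodule.finrank_mono fun F hF => ?_).trans hp⟩
  rw [mem_commonKer_singCond] at hF ⊢
  intro b j
  have := hF (Fin.castLE hs (finProdFinEquiv b)) j
  simp only [Fin.val_castLE] at this
  rwa [dif_pos (finProdFinEquiv b).2, Fin.eta, Equiv.symm_apply_apply] at this

end Special

section Ideals

lemma aeval_add_sub_mem_sq {R A ι : Type*} [CommRing R] [CommRing A] [Algebra R A] [Fintype ι]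
    {I : Ideal A} (y : ι → A) {h : ι → A} (hh : ∀ i, h i ∈ I) (F : MvPolynomial ι R) :
    aeval (fun i => y i + h i) F - (aeval y F + ∑ i, h i * aeval y (pderiv i F)) ∈ I ^ 2 := by
  classical
  induction F using MvPolynomial.induction_on with
  | C a => simp
  | add F G hF hG =>
    convert add_mem hF hG using 1
    simp only [map_add, mul_add, Finset.sum_add_distrib]
    ring
  | mul_X F j hF =>
    have h1 : ∑ i, h i * aeval y (pderiv i F) ∈ I :=
      Ideal.sum_mem _ fun i _ => I.mul_mem_right _ (hh i)
    have h2 : ∑ i, h i * aeval y (pderiv i (F * X j)) =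
        (∑ i, h i * aeval y (pderiv i F)) * y j + h j * aeval y F := by
      have key (i : ι) : h i * aeval y (pderiv i (F * X j)) =
          h i * aeval y (pderiv i F) * y j + if i = j then h j * aeval y F else 0 := by
        rw [pderiv_mul, map_add, map_mul, map_mul, aeval_X, pderiv_X, Pi.single_apply]
        by_cases hij : i = j
        · subst hij; simp; ring
        · simp [hij, Ne.symm hij]; ring
      simp only [key, Finset.sum_add_distrib, Finset.sum_mul]
      simp
    rw [h2]
    convert add_mem (Ideal.mul_mem_right (y j + h j) _ hF)
      (sq I ▸ Ideal.mul_mem_mul h1 (hh j)) using 1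
    simp only [map_mul, aeval_X]
    ring

lemma aeval_mem_pow_of_isHomogeneous {R A ι : Type*} [CommRing R] [CommRing A] [Algebra R A]
    {I : Ideal A} {d : ℕ} {F : MvPolynomial ι R} (hF : F.IsHomogeneous d) {g : ι → A}
    (hg : ∀ i, g i ∈ I) : aeval g F ∈ I ^ d := by
  rw [aeval_def, eval₂_eq]
  refine Ideal.sum_mem _ fun a ha => Ideal.mul_mem_left _ _ ?_
  have h : a.degree = d := by
    simpa [Finsupp.weight_apply, Finsupp.degree_apply, Finsupp.sum] using hF (mem_support_iff.mp ha)
  rw [← h, Finsupp.degree_apply, ← Finset.prod_pow_eq_pow_sum]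
  exact Ideal.prod_mem_prod fun i _ => Ideal.pow_mem_pow (hg i) _

lemma le_of_mem_support_of_mem_pow {R ι : Type*} [CommRing R] {δ : (ι →₀ ℕ) →+ ℕ}
    {I : Ideal (MvPolynomial ι R)} (hI : ∀ F ∈ I, ∀ a ∈ F.support, 1 ≤ δ a) (k : ℕ) :
    ∀ F ∈ I ^ k, ∀ a ∈ F.support, k ≤ δ a := by
  classical
  induction k with
  | zero => simp
  | succ k ih =>
    intro F hF
    rw [pow_succ] at hF
    refine Submodule.mul_induction_on hF (fun F hF G hG a ha => ?_) fun F G hF hG a ha => ?_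
    · obtain ⟨b, hb, c, hc, rfl⟩ := Finset.mem_add.mp (support_mul F G ha)
      rw [map_add]
      exact add_le_add (ih F hF b hb) (hI G hG c hc)
    · rcases Finset.mem_union.mp (support_add ha) with h | h
      exacts [hF a h, hG a h]

variable {K : Type} [Field K] {ι : Type}

lemma eval_eq_zero_of_mem_linIdeal {S : Set (ι → K)} {p : ι → K} (hp : p ∈ S)
    {F : MvPolynomial ι K} (hF : F ∈ linIdeal K S) : eval p F = 0 := by
  have : linIdeal K S ≤ RingHom.ker (eval p) := Ideal.span_le.mpr fun f hf => hf.2 p hp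
  exact this hF

/-- Membership in the ideal of a double point is tested by the gradient. -/
lemma mem_linIdeal_singleton_sq [Fintype ι] {p : ι → K} (hp : p ≠ 0) {d : ℕ}
    {F : MvPolynomial ι K} (hF : F.IsHomogeneous d) (hF0 : eval p F = 0) :
    F ∈ linIdeal K {p} ^ 2 ↔ ∀ j, eval p (pderiv j F) = 0 := by
  constructor
  · intro h j
    rw [sq] at h
    refine Submodule.mul_induction_on h (fun f hf g hg => ?_) fun f g hf hg => ?_
    · have h1 := eval_eq_zero_of_mem_linIdeal (Set.mem_singleton p) hf
      have h2 := eval_eq_zero_of_mem_linIdeal (Set.mem_singleton p) hg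
      rw [pderiv_mul, map_add, map_mul, map_mul, h1, h2, mul_zero, zero_mul, add_zero]
    · rw [map_add, map_add, hf, hg, add_zero]
  · intro h
    obtain ⟨i, hi⟩ := Function.ne_iff.mp hp
    have hi : p i ≠ 0 := hi
    set Y : MvPolynomial ι K := C (p i)⁻¹ * X i with hY
    have hY1 : Y.IsHomogeneous 1 := by
      simpa using (isHomogeneous_C ι (p i)⁻¹).mul (isHomogeneous_X K i)
    have hl (j : ι) : X j - Y * C (p j) ∈ linIdeal K {p} := by
      refine Ideal.subset_span ⟨(isHomogeneous_X K j).sub ?_, ?_⟩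
      · simpa using hY1.mul (isHomogeneous_C ι (p j))
      · simp [hY, hi]
    have hev {e : ℕ} {G : MvPolynomial ι K} (hG : G.IsHomogeneous e) (hG0 : eval p G = 0) :
        aeval (fun j => Y * C (p j)) G = 0 := by
      have h0 : aeval (fun j => (C (p j) : MvPolynomial ι K)) G = C (eval p G) := by
        rw [← aeval_eq_eval]
        exact aeval_algebraMap_apply (MvPolynomial ι K) p G
      rw [aeval_mul_of_isHomogeneous hG, h0, hG0, C_0, mul_zero]
    have := aeval_add_sub_mem_sq (fun j => Y * C (p j)) hl F
    simpa only [hev hF hF0, hev (IsHomogeneous.pderiv hF) (h _), mul_zero, Finset.sum_const_zero,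
      add_zero, sub_zero, add_sub_cancel, aeval_X_left_apply] using this

lemma linSubst_mem_pow [Fintype ι] {B : Matrix ι ι K} {S : Set (ι → K)} {k : ℕ}
    {F : MvPolynomial ι K} (hF : F ∈ linIdeal K (B.mulVec '' S) ^ k) :
    linSubst B F ∈ linIdeal K S ^ k := by
  have h1 : linIdeal K (B.mulVec '' S) ≤ (linIdeal K S).comap (linSubst B) := by
    refine Ideal.span_le.mpr fun f hf => Ideal.subset_span ⟨isHomogeneous_linSubst B hf.1, ?_⟩
    intro x hx
    rw [eval_linSubst]
    exact hf.2 _ ⟨x, hx, rfl⟩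
  exact Ideal.le_comap_pow (linSubst B) k (Ideal.pow_right_mono h1 k hF)

lemma linSubst_mem_pow_iff [Fintype ι] [DecidableEq ι] {B : Matrix ι ι K} (hB : IsUnit B.det)
    {S : Set (ι → K)} {k : ℕ} {F : MvPolynomial ι K} :
    linSubst B F ∈ linIdeal K S ^ k ↔ F ∈ linIdeal K (B.mulVec '' S) ^ k := by
  refine ⟨fun h => ?_, linSubst_mem_pow⟩
  have : S = B⁻¹.mulVec '' (B.mulVec '' S) := by
    rw [← Set.image_comp]
    have : B⁻¹.mulVec ∘ B.mulVec = id := by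
      ext x : 1
      simp [Matrix.mulVec_mulVec, Matrix.nonsing_inv_mul B hB]
    rw [this, Set.image_id]
  rw [this] at h
  simpa [linSubst_linSubst, Matrix.mul_nonsing_inv B hB, linSubst_one] using linSubst_mem_pow h

lemma eval_single_of_isHomogeneous_one [DecidableEq ι] {f : MvPolynomial ι K}
    (hf : f.IsHomogeneous 1) (i : ι) : eval (Pi.single i 1) f = coeff (Finsupp.single i 1) f := by
  rw [eval_eq, Finset.sum_eq_single (Finsupp.single i 1)]
  · simp
  · intro b hb hbi
    have hb1 := hf (mem_support_iff.mp hb)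
    obtain ⟨j, rfl⟩ := (Finsupp.sum_eq_one_iff b).mp (by simpa [Finsupp.weight_apply] using hb1)
    have hji : j ≠ i := fun h => hbi (by rw [h])
    simp [hji]
  · intro h
    simp [notMem_support_iff.mp h]

/-- A polynomial in the ideal of a coordinate subspace only has monomials that involve the
vanishing coordinates. -/
lemma exists_ne_zero_of_mem_linIdeal [DecidableEq ι] {J : Set ι} {S : Set (ι → K)}
    (hS : ∀ i, i ∉ J → Pi.single i 1 ∈ S) {F : MvPolynomial ι K} (hF : F ∈ linIdeal K S)
    {a : ι →₀ ℕ} (ha : a ∈ F.support) : ∃ j ∈ J, a j ≠ 0 := by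
  have : linIdeal K S ≤ Ideal.span (X '' J) := by
    refine Ideal.span_le.mpr fun f hf => mem_ideal_span_X_image.mpr fun b hb => ?_
    have hb1 : b.degree = 1 := by
      simpa [Finsupp.weight_apply, Finsupp.degree_apply, Finsupp.sum] using
        hf.1 (mem_support_iff.mp hb)
    obtain ⟨i, rfl⟩ : ∃ i, b = Finsupp.single i 1 := by
      rw [Finsupp.degree_apply] at hb1
      exact (Finsupp.sum_eq_one_iff b).mp hb1
    refine ⟨i, ?_, by simp⟩
    by_contra hi
    refine mem_support_iff.mp hb ?_
    have := hf.2 _ (hS i hi)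
    rwa [eval_single_of_isHomogeneous_one hf.1] at this
  exact mem_ideal_span_X_image.mp (this hF) a ha

variable {n m d : ℕ}

variable (K) in
/-- The coordinate points spanning the first linear subspace. -/
def axisPoint (n m : ℕ) (i : Fin n) : Fin (n + (m + 1)) → K :=
  Pi.single (Fin.castAdd (m + 1) i) 1

variable (K) in
/-- The coordinate points spanning the second linear subspace. -/
def axisPoint' (n m : ℕ) (i : Fin m) : Fin (n + (m + 1)) → K :=
  Pi.single (Fin.natAdd n i.castSucc) 1

lemma X_natAdd_mem (j : Fin (m + 1)) :
    (X (Fin.natAdd n j) : MvPolynomial _ K) ∈ linIdeal K (Set.range (axisPoint K n m)) := by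
  refine Ideal.subset_span ⟨isHomogeneous_X K _, ?_⟩
  rintro _ ⟨i, rfl⟩
  rw [eval_X, axisPoint, Pi.single_eq_of_ne]
  simp [Fin.ext_iff]
  omega

lemma X_specialVar_mem (k : Fin (n + 1)) :
    (X (specialVar n m k) : MvPolynomial _ K) ∈ linIdeal K (Set.range (axisPoint' K n m)) := by
  refine Ideal.subset_span ⟨isHomogeneous_X K _, ?_⟩
  rintro _ ⟨i, rfl⟩
  rw [eval_X, axisPoint', Pi.single_eq_of_ne]
  refine Fin.lastCases ?_ (fun l => ?_) k
  · rw [specialVar_last]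
    exact fun h => (Fin.castSucc_ne_last i) (Fin.natAdd_injective _ _ h).symm
  · rw [specialVar_castSucc]
    simp [Fin.ext_iff]
    omega

lemma assemble_mem (F : Fin (n + 1) → Forms (Fin (m + 1)) K d) :
    (assemble K n m d F).1 ∈ linIdeal K (Set.range (axisPoint K n m)) ^ d ∧
      (assemble K n m d F).1 ∈ linIdeal K (Set.range (axisPoint' K n m)) := by
  rw [coe_assemble]
  refine ⟨Ideal.sum_mem _ fun k _ => Ideal.mul_mem_left _ _ ?_,
    Ideal.sum_mem _ fun k _ => Ideal.mul_mem_right _ _ (X_specialVar_mem k)⟩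
  rw [← aeval_X_left_apply (rename _ _), aeval_rename]
  exact aeval_mem_pow_of_isHomogeneous (F k).2 fun i => X_natAdd_mem i

lemma monomial_mem_range_assemble {a : Fin (n + (m + 1)) →₀ ℕ} (ha : a.degree = d + 1)
    (h1 : d ≤ ∑ j, a (Fin.natAdd n j)) (h2 : ∃ k, a (specialVar n m k) ≠ 0) (c : K) :
    ∃ F, (assemble K n m d F : MvPolynomial (Fin (n + (m + 1))) K) = monomial a c := by
  have hdeg (b : Fin (n + (m + 1)) →₀ ℕ) :
      b.degree = ∑ i, b (Fin.castAdd (m + 1) i) + ∑ j, b (Fin.natAdd n j) := by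
    rw [Finsupp.degree_eq_sum, Fin.sum_univ_add]
  obtain ⟨k, hk, hk'⟩ : ∃ k, a (specialVar n m k) ≠ 0 ∧
      ∀ i : Fin n, (a - Finsupp.single (specialVar n m k) 1 : Fin (n + (m + 1)) →₀ ℕ)
        (Fin.castAdd (m + 1) i) = 0 := by
    by_cases h : ∃ i : Fin n, a (Fin.castAdd (m + 1) i) ≠ 0
    · obtain ⟨i, hi⟩ := h
      refine ⟨i.castSucc, by simpa using hi, fun i' => ?_⟩
      have h3 := hdeg a
      rw [ha, ← Finset.add_sum_erase _ _ (Finset.mem_univ i)] at h3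
      rw [specialVar_castSucc]
      by_cases hii : i' = i
      · subst hii
        simp only [Finsupp.coe_tsub, Pi.sub_apply, Finsupp.single_eq_same]
        omega
      · have : a (Fin.castAdd (m + 1) i') ≤
            ∑ x ∈ Finset.univ.erase i, a (Fin.castAdd (m + 1) x) :=
          Finset.single_le_sum (f := fun x => a (Fin.castAdd (m + 1) x)) (fun _ _ => Nat.zero_le _)
            (by simpa using hii)
        simp only [Finsupp.coe_tsub, Pi.sub_apply]
        omega
    · push Not at h
      obtain ⟨k, hk⟩ := h2
      exact ⟨k, hk, fun i => by simp [h i]⟩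
  set a' := a - Finsupp.single (specialVar n m k) 1 with ha'
  have haa : a = Finsupp.single (specialVar n m k) 1 + a' := by
    ext i
    by_cases hi : i = specialVar n m k
    · subst hi
      simp [ha']
      omega
    · simp [ha', Finsupp.single_eq_of_ne hi]
  let b : Fin (m + 1) →₀ ℕ := a'.comapDomain (Fin.natAdd n) (Fin.natAdd_injective _ _).injOn
  have hb : b.mapDomain (Fin.natAdd n) = a' := by
    ext i
    refine Fin.addCases (fun i => ?_) (fun j => ?_) i
    · rw [hk' i, Finsupp.mapDomain_of_notMem_range]
      rintro ⟨j, hj⟩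
      simp [Fin.ext_iff] at hj
      omega
    · rw [Finsupp.mapDomain_apply (Fin.natAdd_injective _ _)]
      rfl
  have hbd : b.degree = d := by
    have h3 : a.degree = 1 + a'.degree := by
      conv_lhs => rw [haa]
      simp
    rw [hdeg a', Finset.sum_eq_zero fun i _ => hk' i, zero_add] at h3
    rw [Finsupp.degree_eq_sum]
    change ∑ j, a' (Fin.natAdd n j) = d
    omega
  refine ⟨Pi.single k ⟨monomial b c, isHomogeneous_monomial c hbd⟩, ?_⟩
  rw [coe_assemble, Finset.sum_eq_single k]
  · rw [Pi.single_eq_same, rename_monomial, hb, X, monomial_mul, one_mul, ← haa]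
  · intro k' _ hk'
    rw [Pi.single_eq_of_ne hk', Submodule.coe_zero, map_zero, mul_zero]
  · simp

/-- The forms of degree `d + 1` in the ideal of the two linear subspaces. -/
lemma mem_range_assemble {G : MvPolynomial (Fin (n + (m + 1))) K} (hG : G.IsHomogeneous (d + 1)) :
    (∃ F, (assemble K n m d F).1 = G) ↔
      G ∈ linIdeal K (Set.range (axisPoint K n m)) ^ d ∧
        G ∈ linIdeal K (Set.range (axisPoint' K n m)) := by
  constructor
  · rintro ⟨F, rfl⟩
    exact assemble_mem F
  rintro ⟨h1, h2⟩
  have h3 : ∀ a ∈ G.support,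
      d ≤ (∑ j : Fin (m + 1), Finsupp.applyAddHom (M := ℕ) (Fin.natAdd n j)) a := by
    refine le_of_mem_support_of_mem_pow
      (fun F hF a ha => ?_) d G h1
    have hS : ∀ i, i ∉ Set.range (Fin.natAdd n (m := m + 1)) →
        Pi.single i 1 ∈ Set.range (axisPoint K n m) :=
      Fin.addCases (fun i _ => ⟨i, rfl⟩) (fun j hj => (hj ⟨j, rfl⟩).elim)
    obtain ⟨_, ⟨j, rfl⟩, hj⟩ := exists_ne_zero_of_mem_linIdeal hS hF ha
    rw [AddMonoidHom.finsetSum_apply]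
    exact (Nat.one_le_iff_ne_zero.mpr hj).trans (Finset.single_le_sum
      (f := fun j => Finsupp.applyAddHom (Fin.natAdd n j) a) (fun _ _ => Nat.zero_le _)
      (Finset.mem_univ j))
  have h4 : ∀ a ∈ G.support, ∃ k, a (specialVar n m k) ≠ 0 := by
    intro a ha
    have hS : ∀ i, i ∉ Set.range (specialVar n m) →
        Pi.single i 1 ∈ Set.range (axisPoint' K n m) :=
      Fin.addCases (fun i hi => (hi ⟨i.castSucc, specialVar_castSucc i⟩).elim)
        (Fin.lastCases (fun hi => (hi ⟨Fin.last n, specialVar_last⟩).elim) fun j _ => ⟨j, rfl⟩)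
    obtain ⟨_, ⟨k, rfl⟩, hk⟩ := exists_ne_zero_of_mem_linIdeal hS h2 ha
    exact ⟨k, hk⟩
  suffices G ∈ LinearMap.range ((Forms _ K (d + 1)).subtype ∘ₗ assemble K n m d) by
    obtain ⟨F, hF⟩ := this
    exact ⟨F, hF⟩
  rw [G.as_sum]
  refine Submodule.sum_mem _ fun a ha => ?_
  have hd : a.degree = d + 1 := by
    simpa [Finsupp.weight_apply, Finsupp.degree_apply, Finsupp.sum] using
      hG (mem_support_iff.mp ha)
  obtain ⟨F, hF⟩ := monomial_mem_range_assemble hd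
    (by simpa only [AddMonoidHom.finsetSum_apply] using! h3 a ha) (h4 a ha) (coeff a G)
  exact ⟨F, hF⟩

end Ideals

section Dimension

variable {K : Type} [Field K] [CharZero K] {ι : Type}

lemma mem_linIdeal_singleton_sq_iff_gradAt [Fintype ι] {p : ι → K} (hp : p ≠ 0) {d : ℕ}
    (F : Forms ι K (d + 1)) : F.1 ∈ linIdeal K {p} ^ 2 ↔ ∀ j, gradAt (d + 1) p j F = 0 := by
  have h : eval p F.1 = 0 → (F.1 ∈ linIdeal K {p} ^ 2 ↔ ∀ j, gradAt (d + 1) p j F = 0) :=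
    fun h => by simpa only [gradAt_apply] using mem_linIdeal_singleton_sq hp F.2 h
  refine ⟨fun hF => (h ?_).mp hF, fun hF => (h ?_).mpr hF⟩
  · exact eval_eq_zero_of_mem_linIdeal (Set.mem_singleton p) (Ideal.pow_le_self two_ne_zero hF)
  · rw [← evalAt_apply]
    exact evalAt_eq_zero (Nat.succ_ne_zero d) hF

omit [CharZero K] in
lemma gradAt_adjugate_formSubst [Fintype ι] [DecidableEq ι] {B : Matrix ι ι K} (hB : B.det ≠ 0)
    {d : ℕ} {p : ι → K} {F : Forms ι K (d + 1)} :
    (∀ j, gradAt (d + 1) (B.adjugate.mulVec p) j (formSubst (d + 1) B F) = 0) ↔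
      ∀ j, gradAt (d + 1) p j F = 0 := by
  have h (j : ι) : gradAt (d + 1) (B.adjugate.mulVec p) j (formSubst (d + 1) B F) =
      B.det ^ d * B.transpose.mulVec (fun i => gradAt (d + 1) p i F) j := by
    rw [gradAt_formSubst, Matrix.mulVec_mulVec, Matrix.mul_adjugate, Matrix.smul_mulVec,
      Matrix.one_mulVec]
    simp only [gradAt_smul, Nat.add_sub_cancel, Matrix.mulVec, dotProduct, Finset.mul_sum,
      Matrix.transpose_apply]
    exact Finset.sum_congr rfl fun i _ => by ring
  simp only [h, mul_eq_zero, pow_eq_zero_iff', hB, false_and, false_or]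
  refine ⟨fun h0 => ?_, fun h0 j => ?_⟩
  · exact congrFun (Matrix.eq_zero_of_mulVec_eq_zero (by rwa [Matrix.det_transpose]) (funext h0))
  · simp [Matrix.mulVec, dotProduct, h0]

variable {n m d s : ℕ}

/-- After a change of coordinates, the degree `d + 1` piece of the ideal of `X` consists of the
`F` in the range of `assemble` that are singular at the points. -/
lemma finrank_piece_eq {B : Matrix (Fin (n + (m + 1))) (Fin (n + (m + 1))) K} (hB : B.det ≠ 0)
    {a : Fin n → Fin (n + (m + 1)) → K} (ha : ∀ i, B.mulVec (axisPoint K n m i) = a i)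
    {b : Fin m → Fin (n + (m + 1)) → K} (hb : ∀ i, B.mulVec (axisPoint' K n m i) = b i)
    {p : Fin s → Fin (n + (m + 1)) → K} (hp : ∀ i, p i ≠ 0) :
    Module.finrank K (piece K (linIdeal K (Set.range a) ^ d ⊓ linIdeal K (Set.range b) ⊓
      ⨅ i, linIdeal K {p i} ^ 2) (d + 1)) =
    Module.finrank K (commonKer (singCond d fun i => B.adjugate.mulVec (p i))) := by
  have hB' : IsUnit B.det := hB.isUnit
  have ha' : Set.range a = B.mulVec '' Set.range (axisPoint K n m) := by
    rw [← Set.range_comp]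
    exact congrArg Set.range (funext fun i => (ha i).symm)
  have hb' : Set.range b = B.mulVec '' Set.range (axisPoint' K n m) := by
    rw [← Set.range_comp]
    exact congrArg Set.range (funext fun i => (hb i).symm)
  have h1 (F : MvPolynomial (Fin (n + (m + 1))) K) : linSubst B⁻¹ (linSubst B F) = F := by
    rw [linSubst_linSubst, Matrix.mul_nonsing_inv B hB', linSubst_one]
  have h2 (F : MvPolynomial (Fin (n + (m + 1))) K) : linSubst B (linSubst B⁻¹ F) = F := by
    rw [linSubst_linSubst, Matrix.nonsing_inv_mul B hB', linSubst_one]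
  have h3 (G : Forms (Fin (n + (m + 1))) K (d + 1)) (F) (hF : assemble K n m d F =
      formSubst (d + 1) B G) : G.1 ∈ ⨅ i, linIdeal K {p i} ^ 2 ↔
        F ∈ commonKer (singCond d fun i => B.adjugate.mulVec (p i)) := by
    rw [mem_commonKer_singCond, Submodule.mem_iInf, hF]
    refine forall_congr' fun i => ?_
    rw [gradAt_adjugate_formSubst hB, mem_linIdeal_singleton_sq_iff_gradAt (hp i)]
  have h4 (G : Forms (Fin (n + (m + 1))) K (d + 1)) :
      (∃ F, assemble K n m d F = formSubst (d + 1) B G) ↔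
        G.1 ∈ linIdeal K (Set.range a) ^ d ⊓ linIdeal K (Set.range b) := by
    have := mem_range_assemble (formSubst (d + 1) B G).2
    rw [Submodule.mem_inf, ha', hb', ← linSubst_mem_pow_iff hB',
      ← pow_one (linIdeal K (B.mulVec '' _)), ← linSubst_mem_pow_iff hB', pow_one]
    simpa only [Subtype.ext_iff] using! this
  let g : (Fin (n + 1) → Forms (Fin (m + 1)) K d) →ₗ[K] MvPolynomial (Fin (n + (m + 1))) K :=
    (linSubst B⁻¹).toLinearMap ∘ₗ (Forms _ K (d + 1)).subtype ∘ₗ assemble K n m d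
  have hg : Function.Injective g := by
    have : Function.Injective (linSubst B⁻¹) := Function.LeftInverse.injective h2
    exact this.comp (Subtype.val_injective.comp assemble_injective)
  rw [(Submodule.equivMapOfInjective g hg _).finrank_eq]
  refine congrArg (fun V : Submodule K (MvPolynomial (Fin (n + (m + 1))) K) =>
    Module.finrank K V) (Submodule.ext fun G => ?_)
  constructor
  · rintro ⟨hG, hG'⟩
    obtain ⟨F, hF⟩ := (h4 ⟨G, hG'⟩).mpr hG.1
    refine ⟨F, (h3 ⟨G, hG'⟩ F hF).mp hG.2, ?_⟩
    change linSubst B⁻¹ (assemble K n m d F).1 = G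
    rw [hF]
    exact h1 G
  · rintro ⟨F, hF, rfl⟩
    have hG : (g F).IsHomogeneous (d + 1) := isHomogeneous_linSubst _ (assemble K n m d F).2
    have hF' : assemble K n m d F = formSubst (d + 1) B ⟨g F, hG⟩ := Subtype.ext (h2 _).symm
    exact ⟨⟨(h4 ⟨g F, hG⟩).mp ⟨F, hF'⟩, (h3 ⟨g F, hG⟩ F hF').mpr hF⟩, hG⟩

variable (K n m) in
/-- A matrix whose columns are the points of `P` spanning the two linear subspaces, completed by
a coordinate vector. -/
def frame (x : ℕ × ℕ → K) : Matrix (Fin (n + (m + 1))) (Fin (n + (m + 1))) K :=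
  Matrix.of fun i j => if (j : ℕ) < n + m then x (j, i) else (1 : Matrix _ _ K) i j

omit [CharZero K]

lemma isPolyFun_frame_apply (i j) : IsPolyFun fun x => frame K n m x i j := by
  simp only [frame, Matrix.of_apply]
  split_ifs
  · exact IsPolyFun.coord _
  · exact IsPolyFun.const _

lemma frame_mulVec_axisPoint (x : ℕ × ℕ → K) (i : Fin n) :
    (frame K n m x).mulVec (axisPoint K n m i) = fun c : Fin _ => x (i, c) := by
  ext c
  have : (i : ℕ) < n + m := by omega
  simp [axisPoint, frame, this]

lemma frame_mulVec_axisPoint' (x : ℕ × ℕ → K) (i : Fin m) :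
    (frame K n m x).mulVec (axisPoint' K n m i) = fun c : Fin _ => x (n + i, c) := by
  ext c
  simp [axisPoint', frame]

variable (K n m) in
/-- The `i`-th double point in the coordinates given by `frame`, up to a scalar. -/
def framePoint (x : ℕ × ℕ → K) (i : Fin s) : Fin (n + (m + 1)) → K :=
  (frame K n m x).adjugate.mulVec fun c : Fin _ => x (n + m + i, c)

lemma isPolyFun_singCond_framePoint (a : Fin s × Fin (n + (m + 1)))
    (F : Fin (n + 1) → Forms (Fin (m + 1)) K d) :
    IsPolyFun fun x => singCond d (framePoint K n m x) a F := by
  refine isPolyFun_gradAt (d + 1) (q := fun x => framePoint K n m x a.1) (fun i => ?_) _ _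
  simp only [framePoint, Matrix.mulVec, dotProduct]
  exact IsPolyFun.sum _ fun j => (IsPolyFun.adjugate (f := fun i j x => frame K n m x i j)
    isPolyFun_frame_apply _ _).mul (IsPolyFun.coord _)

lemma exists_framePoint_eq (p : Fin s → Fin (n + (m + 1)) → K) :
    ∃ x, frame K n m x = 1 ∧ framePoint K n m x = p := by
  let x : ℕ × ℕ → K := fun a => if a.1 < n + m then (1 : Matrix ℕ ℕ K) a.2 a.1 else
    if h : a.1 - (n + m) < s ∧ a.2 < n + (m + 1) then p ⟨_, h.1⟩ ⟨_, h.2⟩ else 0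
  have hx : frame K n m x = 1 := by
    ext i j
    simp only [frame, Matrix.of_apply, x]
    split_ifs
    · simp [Matrix.one_apply, Fin.ext_iff]
    · rfl
  refine ⟨x, hx, funext fun i => ?_⟩
  rw [framePoint, hx]
  ext c
  have := c.2
  simp [x]

lemma eventually_det_frame_ne_zero : ∀ᶠ x in generic (ℕ × ℕ) K, (frame K n m x).det ≠ 0 := by
  obtain ⟨x, hx, -⟩ := exists_framePoint_eq (K := K) (n := n) (m := m) (s := 0) Fin.elim0
  refine (IsPolyFun.det (f := fun i j x => frame K n m x i j)
    isPolyFun_frame_apply).eventually_ne_zero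
    (x₀ := x) ?_
  change (frame K n m x).det ≠ 0
  rw [hx, Matrix.det_one]
  exact one_ne_zero

variable [CharZero K]

lemma eventually_finrank_piece_eq : ∀ᶠ x in generic (ℕ × ℕ) K,
    Module.finrank K (piece K
      (linIdeal K (Set.range fun (i : Fin n) (c : Fin (n + (m + 1))) => x (i, c)) ^ d ⊓
        linIdeal K (Set.range fun (i : Fin m) (c : Fin (n + (m + 1))) => x (n + i, c)) ⊓
        ⨅ i : Fin s, linIdeal K {fun c : Fin (n + (m + 1)) => x (n + m + i, c)} ^ 2) (d + 1)) =
    Module.finrank K (commonKer (singCond d (framePoint (s := s) K n m x))) := by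
  have h : ∀ᶠ x in generic (ℕ × ℕ) K, ∀ i : Fin s, x (n + m + i, 0) ≠ 0 :=
    Filter.eventually_all.mpr fun i =>
      (IsPolyFun.coord _).eventually_ne_zero (x₀ := fun _ => 1) one_ne_zero
  filter_upwards [h, eventually_det_frame_ne_zero (n := n) (m := m)] with x hx hx'
  exact finrank_piece_eq hx' (frame_mulVec_axisPoint x) (frame_mulVec_axisPoint' x)
    fun i h0 => hx i (congrFun h0 ⟨0, by omega⟩)

lemma eventually_finrank_commonKer_framePoint (hd : 3 ≤ d) (hn : 1 ≤ n) (hm : 1 ≤ m) {t : ℕ}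
    (ht : t * (m + n + 1) ≤ (m + d).choose d) (hs : s ≤ (n + 1) * t) :
    ∀ᶠ x in generic (ℕ × ℕ) K,
      s * (n + m + 1) + Module.finrank K (commonKer (singCond d (framePoint (s := s) K n m x))) =
        (n + 1) * (m + d).choose d := by
  obtain ⟨p, hp⟩ := exists_linearIndependent_singCond K hd hn hm ht hs
  obtain ⟨x₀, -, rfl⟩ := exists_framePoint_eq p
  have := eventually_linearIndependent (v := fun a x => singCond d (framePoint K n m x) a)
    (fun a => isPolyFun_dual (isPolyFun_singCond_framePoint a)) hp
  refine this.mono fun x hx => ?_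
  have := finrank_span_add_finrank_commonKer (singCond d (framePoint (s := s) K n m x))
  rwa [finrank_span_eq_card hx, finrank_pi_forms, Fintype.card_prod, Fintype.card_fin,
    Fintype.card_fin] at this

lemma eventually_finrank_commonKer_framePoint_eq_zero (hd : 3 ≤ d) (hn : 1 ≤ n) (hm : 1 ≤ m)
    {t : ℕ} (ht : (m + d).choose d ≤ t * (m + n + 1)) (hs : (n + 1) * t ≤ s) :
    ∀ᶠ x in generic (ℕ × ℕ) K,
      Module.finrank K (commonKer (singCond d (framePoint (s := s) K n m x))) = 0 := by
  obtain ⟨p, hp⟩ := exists_finrank_commonKer_singCond_eq_zero K hd hn hm ht hs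
  obtain ⟨x₀, -, rfl⟩ := exists_framePoint_eq p
  exact (eventually_finrank_commonKer_le isPolyFun_singCond_framePoint hp).mono
    fun x hx => Nat.le_zero.mp hx

end Dimension

/-- **Corollary.**  Let `d ≥ 3`, `n, m ≥ 1`.  Let `s₁` be the largest multiple of `n+1`
with `s₁ ≤ ⌊(n+1)·C(m+d,d)/(m+n+1)⌋` (equivalently `s₁(m+n+1) ≤ (n+1)·C(m+d,d)`), and
`s₂` the smallest multiple of `n+1` with `s₂ ≥ ⌈(n+1)·C(m+d,d)/(m+n+1)⌉` (equivalently
`s₂(m+n+1) ≥ (n+1)·C(m+d,d)`).  For generic `H₁ ≅ P^{n-1}`, `H₂ ≅ P^{m-1}` and points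
`pt₁,…,pt_s` in `P^{n+m}`, the scheme `X = dH₁ + H₂ + 2pt₁ + ⋯ + 2pt_s` satisfies
`dim (I_X)_{d+1} = (n+1)·C(m+d,d) − s(n+m+1)` for `s ≤ s₁`, and `dim (I_X)_{d+1} = 0`
for `s ≥ s₂`. -/
theorem stmt1 (K : Type) [Field K] [IsAlgClosed K] [CharZero K]
    (n m d : ℕ) (hd : 3 ≤ d) (hn : 1 ≤ n) (hm : 1 ≤ m)
    (s₁ s₂ : ℕ)
    (hs₁ : (n + 1) ∣ s₁ ∧ s₁ * (m + n + 1) ≤ (n + 1) * ((m + d).choose d) ∧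
      ∀ s', (n + 1) ∣ s' → s' * (m + n + 1) ≤ (n + 1) * ((m + d).choose d) → s' ≤ s₁)
    (hs₂ : (n + 1) ∣ s₂ ∧ (n + 1) * ((m + d).choose d) ≤ s₂ * (m + n + 1) ∧
      ∀ s', (n + 1) ∣ s' → (n + 1) * ((m + d).choose d) ≤ s' * (m + n + 1) → s₂ ≤ s')
    (s : ℕ) :
    ∃ g : MvPolynomial (ℕ × ℕ) K, g ≠ 0 ∧
      ∀ P : ℕ → ℕ → K, MvPolynomial.eval (fun ij => P ij.1 ij.2) g ≠ 0 →
        let a : Fin n → (Fin (n + m + 1) → K) := fun i c => P (i : ℕ) (c : ℕ)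
        let b : Fin m → (Fin (n + m + 1) → K) := fun i c => P (n + (i : ℕ)) (c : ℕ)
        let pt : Fin s → (Fin (n + m + 1) → K) := fun i c => P (n + m + (i : ℕ)) (c : ℕ)
        let IX : Ideal (MvPolynomial (Fin (n + m + 1)) K) :=
          (linIdeal K (Set.range a)) ^ d ⊓ linIdeal K (Set.range b)
            ⊓ (⨅ i : Fin s, (linIdeal K {pt i}) ^ 2)
        (s ≤ s₁ →
          (Module.finrank K (piece K IX (d + 1)) : ℤ)
            = (n + 1) * ((m + d).choose d) - s * (n + m + 1)) ∧
        (s₂ ≤ s → Module.finrank K (piece K IX (d + 1)) = 0) := by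
  obtain ⟨⟨t₁, rfl⟩, ht₁, -⟩ := hs₁
  obtain ⟨⟨t₂, rfl⟩, ht₂, -⟩ := hs₂
  rw [mul_assoc, mul_le_mul_iff_right₀ n.succ_pos] at ht₁ ht₂
  have h₁ : ∀ᶠ x in generic (ℕ × ℕ) K, s ≤ (n + 1) * t₁ →
      s * (n + m + 1) + Module.finrank K (commonKer (singCond d (framePoint (s := s) K n m x))) =
        (n + 1) * (m + d).choose d := by
    rw [Filter.eventually_imp_distrib_left]
    exact eventually_finrank_commonKer_framePoint hd hn hm ht₁
  have h₂ : ∀ᶠ x in generic (ℕ × ℕ) K, (n + 1) * t₂ ≤ s →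
      Module.finrank K (commonKer (singCond d (framePoint (s := s) K n m x))) = 0 := by
    rw [Filter.eventually_imp_distrib_left]
    exact eventually_finrank_commonKer_framePoint_eq_zero hd hn hm ht₂
  obtain ⟨g, hg, h⟩ := eventually_generic.mp
    ((eventually_finrank_piece_eq (n := n) (m := m) (d := d) (s := s)).and (h₁.and h₂))
  refine ⟨g, hg, fun P hP => ?_⟩
  obtain ⟨h0, h1, h2⟩ := h _ hP
  refine ⟨fun hs => ?_, fun hs => h0.trans (h2 hs)⟩
  have h1 := h1 hs
  rw [← h0] at h1
  rw [eq_sub_iff_add_eq, add_comm]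
  exact_mod_cast h1
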